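/- Let λ < 9. Then there exists a constant C_λ > 0 such that for every u ∈ C₀^∞(B⁴) satisfying ∫_{B⁴} |Δu(x)|² dx − λ ∫_{B⁴} u(x)²/(1 − |x|²)⁴ dx ≤ 1, one has 16 ∫_{B⁴} (e^{32π²u(x)²} − 1)/(1 − |x|²)⁴ dx ≤ C_λ. -/

import Mathlib

open MeasureTheory Real

noncomputable section

/-- The Euclidean space `ℝ⁴`. -/
abbrev E4 := EuclideanSpace ℝ (Fin 4)

/-- The Euclidean Laplacian on `ℝ⁴`. -/
def lapE (u : E4 → ℝ) (x : E4) : ℝ :=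
  ∑ i, fderiv ℝ (fun y => fderiv ℝ u y (EuclideanSpace.single i 1)) x (EuclideanSpace.single i 1)

end

theorem lintegral_Ioi_of_hasDerivAt_of_nonneg {g g' : ℝ → ℝ} {a l : ℝ}
    (hd : ∀ x ∈ Set.Ici a, HasDerivAt g (g' x) x) (h0 : ∀ x ∈ Set.Ioi a, 0 ≤ g' x)
    (hl : Filter.Tendsto g Filter.atTop (nhds l)) :
    ∫⁻ x in Set.Ioi a, ENNReal.ofReal (g' x) = ENNReal.ofReal (l - g a) := by
  rw [← integral_Ioi_of_hasDerivAt_of_nonneg' hd h0 hl,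
    ofReal_integral_eq_lintegral_ofReal (integrableOn_Ioi_deriv_of_nonneg' hd h0 hl)]
  exact (ae_restrict_mem measurableSet_Ioi).mono h0

theorem tendsto_affine_mul_exp_neg {b : ℝ} (hb : 0 < b) (p q r : ℝ) :
    Filter.Tendsto (fun s : ℝ => (p * s + q) * rexp (-(b * (s - r)))) Filter.atTop (nhds 0) := by
  have h1 := Real.tendsto_pow_mul_exp_neg_atTop_nhds_zero 1
  have h0 := Real.tendsto_pow_mul_exp_neg_atTop_nhds_zero 0
  have hc : Filter.Tendsto (fun s : ℝ => b * s) Filter.atTop Filter.atTop :=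
    Filter.Tendsto.const_mul_atTop hb Filter.tendsto_id
  have := (((h1.comp hc).const_mul (p / b)).add ((h0.comp hc).const_mul q)).mul_const (rexp (b * r))
  simp only [mul_zero, add_zero, zero_mul] at this
  refine this.congr fun s => ?_
  simp only [Function.comp, pow_one, pow_zero, one_mul]
  rw [show -(b * (s - r)) = -(b * s) + b * r by ring, Real.exp_add]
  field_simp

theorem lintegral_Ioi_mul_exp_neg_mul_sub {β s : ℝ} (hβ : 0 < β) (hs : 1 ≤ s) :
    ∫⁻ t in Set.Ioi s, ENNReal.ofReal (2 * β * t * rexp (-(β * s / 2 * (t - s)))) ≤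
      ENNReal.ofReal (4 + 8 / β) := by
  have hs0 : 0 < s := by linarith
  rw [lintegral_Ioi_of_hasDerivAt_of_nonneg
    (g := fun t => (-(4 / s) * t + -(8 / (β * s ^ 2))) * rexp (-(β * s / 2 * (t - s)))) (l := 0)]
  · apply ENNReal.ofReal_le_ofReal
    have : 8 / (β * s ^ 2) ≤ 8 / β := by
      apply div_le_div_of_nonneg_left (by norm_num) hβ
      nlinarith [mul_le_mul hs hs (by norm_num) hs0.le]
    simp only [sub_self, mul_zero, neg_zero, Real.exp_zero, mul_one]
    have : 4 / s * s = 4 := by field_simp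
    linarith
  · intro t _
    have h1 : HasDerivAt (fun t : ℝ => -(β * s / 2 * (t - s))) (-(β * s / 2)) t := by
      exact (((hasDerivAt_id' t).sub_const s).const_mul (β * s / 2)).fun_neg.congr_deriv (by ring)
    have h2 : HasDerivAt (fun t : ℝ => -(4 / s) * t + -(8 / (β * s ^ 2))) (-(4 / s)) t := by
      exact (((hasDerivAt_id' t).const_mul (-(4 / s))).add_const
        (-(8 / (β * s ^ 2)))).congr_deriv (by ring)
    refine (h2.fun_mul h1.exp).congr_deriv ?_
    field_simp
    ring
  · intro t ht
    have : 0 < t := lt_trans hs0 ht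
    positivity
  · exact tendsto_affine_mul_exp_neg (by positivity) _ _ _

theorem lintegral_Iic_mul_exp_neg_mul_sub {β s : ℝ} (hβ : 0 < β) (hs : 0 < s) :
    ∫⁻ t in Set.Iic s, ENNReal.ofReal (2 * β * s * rexp (-(β * s / 4 * (s - t)))) =
      ENNReal.ofReal 8 := by
  have hb : 0 < β * s / 4 := by positivity
  have he : (fun t => 2 * β * s * rexp (-(β * s / 4 * (s - t)))) =
      fun t => (2 * β * s * rexp (-(β * s / 4 * s))) * rexp (β * s / 4 * t) := by
    ext t
    rw [mul_assoc (2 * β * s) (rexp _), ← Real.exp_add]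
    ring_nf
  rw [← ofReal_integral_eq_lintegral_ofReal]
  · congr 1
    rw [he, integral_const_mul, integral_exp_mul_Iic hb, Real.exp_neg]
    field_simp
    norm_num
  · rw [he]
    exact (integrableOn_exp_mul_Iic hb s).const_mul _
  · exact Filter.Eventually.of_forall fun t => by positivity

theorem lintegral_Ioi_mul_exp_neg_sq {β : ℝ} (hβ : 0 < β) :
    ∫⁻ t in Set.Ioi 0, ENNReal.ofReal (2 * β * t * rexp (-(β * t ^ 2 / 2))) =
      ENNReal.ofReal 2 := by
  rw [lintegral_Ioi_of_hasDerivAt_of_nonneg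
    (g := fun t => -2 * rexp (-(β * t ^ 2 / 2))) (l := 0)]
  · simp
  · intro t _
    have h1 : HasDerivAt (fun t : ℝ => -(β * t ^ 2 / 2)) (-(β * t)) t := by
      refine ((((hasDerivAt_pow 2 t).const_mul β).div_const 2).fun_neg).congr_deriv ?_
      norm_num
      ring
    exact (h1.exp.const_mul (-2)).congr_deriv (by ring)
  · intro t ht
    have : 0 < t := ht
    positivity
  · have : Filter.Tendsto (fun t : ℝ => β * t ^ 2 / 2) Filter.atTop Filter.atTop := by
      have := (Filter.tendsto_pow_atTop (α := ℝ) two_ne_zero).const_mul_atTop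
        (show 0 < β / 2 by positivity)
      refine this.congr fun t => by ring
    simpa using (Real.tendsto_exp_neg_atTop_nhds_zero.comp this).const_mul (-2)

/-- A one-dimensional inequality of Moser type for a distribution function `m`. -/
theorem lintegral_distribution_le {β C s₀ : ℝ} (hβ : 0 < β) (hs₀ : 1 ≤ s₀) {m : ℝ → ℝ}
    (hm0 : ∀ s, 0 ≤ m s)
    (hm : ∀ s t, s₀ ≤ s → s ≤ t → 0 < m s → 0 < m t →
      β * (s + t) ^ 2 ≤ 3 * log (1 / m s) + log (1 / m t) + C) :
    ∫⁻ s in Set.Ioi s₀, ENNReal.ofReal (2 * β * s * rexp (β * s ^ 2) * m s) ≤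
      ENNReal.ofReal (rexp ((C + 3) / 4) * (14 + 8 / β)) := by
  by_cases hne : ∃ s, s₀ ≤ s ∧ 0 < m s
  swap
  · push Not at hne
    rw [setLIntegral_congr_fun (g := fun _ => 0) measurableSet_Ioi]
    · simp
    · intro s hs
      have : m s = 0 := le_antisymm (hne s (le_of_lt hs)) (hm0 s)
      simp [this]
  set P : Set ℝ := {s | s₀ ≤ s ∧ 0 < m s} with hP
  set F : ℝ → ℝ := fun s => log (1 / m s) - β * s ^ 2 with hF
  have hbdd : BddBelow (F '' P) := by
    refine ⟨-C / 4, ?_⟩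
    rintro _ ⟨s, hs, rfl⟩
    have := hm s s hs.1 le_rfl hs.2 hs.2
    simp only [hF]
    nlinarith
  have hPne : (F '' P).Nonempty := by
    obtain ⟨s, hs⟩ := hne
    exact ⟨F s, s, hs, rfl⟩
  obtain ⟨_, ⟨a, haP, rfl⟩, ha⟩ := exists_lt_of_csInf_lt hPne (lt_add_one (sInf (F '' P)))
  have hmin : ∀ s ∈ P, F a ≤ F s + 1 := fun s hs => by
    have := csInf_le hbdd (Set.mem_image_of_mem F hs)
    linarith
  have ha1 : 1 ≤ a := hs₀.trans haP.1
  have ha0 : 0 < a := by linarith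
  have hexp : ∀ s ∈ P, rexp (β * s ^ 2) * m s = rexp (-F s) := fun s hs => by
    simp only [hF, neg_sub, one_div, Real.log_inv, sub_neg_eq_add]
    rw [Real.exp_add, Real.exp_log hs.2]
  set A := rexp ((C + 3) / 4) with hA
  have hsub : Set.Ioi s₀ ⊆ Set.Ioi a ∪ Set.Ioc s₀ a := by
    intro s hs
    rcases lt_or_ge a s with h | h
    · exact Or.inl h
    · exact Or.inr ⟨hs, h⟩
  have hI1 : ∫⁻ s in Set.Ioi a, ENNReal.ofReal (2 * β * s * rexp (β * s ^ 2) * m s) ≤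
      ENNReal.ofReal A * ENNReal.ofReal (4 + 8 / β) := by
    refine le_trans ?_ (mul_le_mul_right (lintegral_Ioi_mul_exp_neg_mul_sub hβ ha1) _)
    rw [← lintegral_const_mul _ (by fun_prop)]
    refine setLIntegral_mono (by fun_prop) fun s hs => ?_
    rw [← ENNReal.ofReal_mul (Real.exp_pos _).le]
    apply ENNReal.ofReal_le_ofReal
    have hs' : a < s := hs
    have hs0 : 0 < s := ha0.trans hs'
    rcases (hm0 s).eq_or_lt with h | h
    · rw [← h]; simp only [mul_zero]; positivity
    have hsP : s ∈ P := ⟨haP.1.trans hs'.le, h⟩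
    rw [mul_assoc, hexp s hsP, show A * (2 * β * s * rexp (-(β * a / 2 * (s - a)))) =
      2 * β * s * (A * rexp (-(β * a / 2 * (s - a)))) by ring, hA, ← Real.exp_add]
    apply mul_le_mul_of_nonneg_left _ (by positivity)
    apply Real.exp_le_exp.2
    have h1 := hm a s haP.1 hs'.le haP.2 h
    have h2 := hmin s hsP
    simp only [hF] at h2 ⊢
    nlinarith
  have hI2 : ∫⁻ s in Set.Ioc s₀ a, ENNReal.ofReal (2 * β * s * rexp (β * s ^ 2) * m s) ≤
      ENNReal.ofReal A * (ENNReal.ofReal 8 + ENNReal.ofReal 2) := by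
    have hle : ∀ s ∈ Set.Ioc s₀ a, ENNReal.ofReal (2 * β * s * rexp (β * s ^ 2) * m s) ≤
        ENNReal.ofReal A * (ENNReal.ofReal (2 * β * a * rexp (-(β * a / 4 * (a - s)))) +
          ENNReal.ofReal (2 * β * s * rexp (-(β * s ^ 2 / 2)))) := by
      intro s hs
      have hs0 : 0 < s := by linarith [hs.1]
      rw [← ENNReal.ofReal_add (by positivity) (by positivity),
        ← ENNReal.ofReal_mul (Real.exp_pos _).le]
      apply ENNReal.ofReal_le_ofReal
      rcases (hm0 s).eq_or_lt with h | h
      · rw [← h]; simp only [mul_zero]; positivity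
      have hsP : s ∈ P := ⟨hs.1.le, h⟩
      have hkey : rexp (-F s) ≤ A * rexp (-(β * s / 2 * (a - s))) := by
        rw [hA, ← Real.exp_add]
        apply Real.exp_le_exp.2
        have h1 := hm s a hs.1.le hs.2 h haP.2
        have h2 := hmin s hsP
        simp only [hF] at h2 ⊢
        nlinarith
      rw [mul_assoc, hexp s hsP]
      refine (mul_le_mul_of_nonneg_left hkey (by positivity)).trans ?_
      rw [show 2 * β * s * (A * rexp (-(β * s / 2 * (a - s)))) =
        A * (2 * β * s * rexp (-(β * s / 2 * (a - s)))) by ring]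
      apply mul_le_mul_of_nonneg_left _ (Real.exp_pos _).le
      rcases le_total a (2 * s) with h3 | h3
      · refine le_add_of_le_of_nonneg ?_ (by positivity)
        gcongr 2 * β * ?_ * rexp ?_
        · exact hs.2
        · have : 0 ≤ β * ((2 * s - a) * (a - s)) :=
            mul_nonneg hβ.le (mul_nonneg (by linarith) (by linarith [hs.2]))
          linarith
      · refine le_add_of_nonneg_of_le (by positivity) ?_
        gcongr 2 * β * s * rexp ?_
        have : 0 ≤ β * (s * (a - 2 * s)) :=
            mul_nonneg hβ.le (mul_nonneg (by linarith) (by linarith [hs.2]))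
        linarith
    refine (setLIntegral_mono (by fun_prop) hle).trans ?_
    rw [lintegral_const_mul _ (by fun_prop), lintegral_add_left (by fun_prop)]
    gcongr
    · rw [← lintegral_Iic_mul_exp_neg_mul_sub hβ ha0]
      exact lintegral_mono_set Set.Ioc_subset_Iic_self
    · rw [← lintegral_Ioi_mul_exp_neg_sq hβ]
      exact lintegral_mono_set fun s hs => lt_trans (by linarith) hs.1
  calc _ ≤ _ := lintegral_mono_set hsub
    _ ≤ _ := lintegral_union_le _ _ _
    _ ≤ _ := add_le_add hI1 hI2
    _ = _ := by
      rw [← mul_add, ← ENNReal.ofReal_add (by norm_num) (by norm_num),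
        ← ENNReal.ofReal_add (by positivity) (by norm_num),
        ← ENNReal.ofReal_mul (Real.exp_pos _).le]
      congr 2
      ring

theorem ENNReal.mul_le_half_sq_add_sq (a b : ENNReal) {θ : ℝ} (hθ : 0 < θ) :
    a * b ≤ ENNReal.ofReal (θ / 2) * a ^ 2 + ENNReal.ofReal (1 / (2 * θ)) * b ^ 2 := by
  have h1 : ENNReal.ofReal (θ / 2) ≠ 0 := by
    simpa using hθ
  have h2 : ENNReal.ofReal (1 / (2 * θ)) ≠ 0 := by
    rw [ne_eq, ENNReal.ofReal_eq_zero, not_le]; positivity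
  rcases eq_or_ne a ⊤ with rfl | ha
  · simp [ENNReal.mul_top, h1]
  rcases eq_or_ne b ⊤ with rfl | hb
  · rw [show (⊤ : ENNReal) ^ 2 = ⊤ by simp, ENNReal.mul_top h2]; simp
  lift a to NNReal using ha
  lift b to NNReal using hb
  have key : (a : ℝ) * b ≤ θ / 2 * a ^ 2 + 1 / (2 * θ) * b ^ 2 := by
    have : θ / 2 * (a : ℝ) ^ 2 + 1 / (2 * θ) * b ^ 2 - a * b =
        1 / (2 * θ) * (θ * a - b) ^ 2 := by field_simp; ring
    have h3 : 0 ≤ 1 / (2 * θ) * (θ * a - b) ^ 2 := by positivity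
    linarith
  have := ENNReal.ofReal_le_ofReal key
  rw [ENNReal.ofReal_mul (by positivity), ENNReal.ofReal_add (by positivity) (by positivity),
    ENNReal.ofReal_mul (by positivity), ENNReal.ofReal_mul (by positivity),
    ENNReal.ofReal_pow (by positivity), ENNReal.ofReal_pow (by positivity)] at this
  simpa using this

theorem ENNReal.mul_le_half_add_sq (a b : ENNReal) : a * b ≤ 2⁻¹ * a ^ 2 + 2⁻¹ * b ^ 2 := by
  have := ENNReal.mul_le_half_sq_add_sq a b one_pos
  have h : ENNReal.ofReal (1 / 2) = 2⁻¹ := by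
    rw [one_div, ENNReal.ofReal_inv_of_pos two_pos]; simp
  rwa [mul_one, h] at this

section Abstract

variable {X : Type*} [MeasurableSpace X] {μ : Measure X}

theorem lintegral_mul_kernel_le {x' : X} {κ : X → X → ENNReal} {D A N : ENNReal}
    {p q : X → X → ENNReal} (hp : Measurable p.uncurry) (hq : Measurable q.uncurry) [SFinite μ]
    (hk : ∀ x y, κ x y ≤ p x y + q x y) (hsym : ∀ x y, p x y = p y x)
    (hpA : ∀ᵐ x ∂μ, ∫⁻ y, p x y ∂μ ≤ A) (hqD : ∀ x y, q x y ≤ D)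
    (hqN : ∀ᵐ x ∂μ, ∫⁻ y, q x y ^ 2 ∂μ ≤ N)
    (hpA' : ∫⁻ y, p x' y ∂μ ≤ A) (hqN' : ∫⁻ y, q x' y ^ 2 ∂μ ≤ N) (S : Set X) :
    ∫⁻ x in S, ∫⁻ y, κ x y * κ x' y ∂μ ∂μ ≤ μ S * (N + 2 * (D * A)) + A * A := by
  have hpx : ∀ x, Measurable (p x) := fun x => hp.of_uncurry_left
  have hqx : ∀ x, Measurable (q x) := fun x => hq.of_uncurry_left
  have hpy : ∀ y, Measurable (fun x => p x y) := fun y => hp.of_uncurry_right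
  have h1 : ∀ᵐ x ∂(μ.restrict S), ∫⁻ y, κ x y * κ x' y ∂μ ≤
      (N + 2 * (D * A)) + ∫⁻ y, p x y * p x' y ∂μ := by
    refine ae_restrict_of_ae ?_
    filter_upwards [hpA, hqN] with x hx hx2
    calc ∫⁻ y, κ x y * κ x' y ∂μ
        ≤ ∫⁻ y, ((2⁻¹ * q x y ^ 2 + 2⁻¹ * q x' y ^ 2) + (D * p x y + D * p x' y)) +
            p x y * p x' y ∂μ := by
          refine lintegral_mono fun y => ?_
          calc κ x y * κ x' y ≤ (p x y + q x y) * (p x' y + q x' y) :=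
                mul_le_mul' (hk x y) (hk x' y)
            _ = (q x y * q x' y + (q x' y * p x y + q x y * p x' y)) + p x y * p x' y := by ring
            _ ≤ _ := by
              gcongr
              · exact ENNReal.mul_le_half_add_sq _ _
              · exact hqD _ _
              · exact hqD _ _
      _ = (2⁻¹ * ∫⁻ y, q x y ^ 2 ∂μ + 2⁻¹ * ∫⁻ y, q x' y ^ 2 ∂μ) +
            (D * ∫⁻ y, p x y ∂μ + D * ∫⁻ y, p x' y ∂μ) + ∫⁻ y, p x y * p x' y ∂μ := by
          have m1 := hpx x
          have m2 := hpx x'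
          have m3 := hqx x
          have m4 := hqx x'
          rw [lintegral_add_left (by fun_prop), lintegral_add_left (by fun_prop),
            lintegral_add_left (by fun_prop), lintegral_add_left (by fun_prop),
            lintegral_const_mul _ (by fun_prop), lintegral_const_mul _ (by fun_prop),
            lintegral_const_mul _ (by fun_prop), lintegral_const_mul _ (by fun_prop)]
      _ ≤ (2⁻¹ * N + 2⁻¹ * N) + (D * A + D * A) + ∫⁻ y, p x y * p x' y ∂μ := by gcongr
      _ = _ := by
          rw [← add_mul, ENNReal.inv_two_add_inv_two, one_mul, two_mul]
  have hm2 : Measurable (Function.uncurry fun x y => p x y * p x' y) :=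
    hp.mul ((hpx x').comp measurable_snd)
  calc ∫⁻ x in S, ∫⁻ y, κ x y * κ x' y ∂μ ∂μ
      ≤ ∫⁻ x in S, (N + 2 * (D * A)) + ∫⁻ y, p x y * p x' y ∂μ ∂μ := lintegral_mono_ae h1
    _ = μ S * (N + 2 * (D * A)) + ∫⁻ x in S, ∫⁻ y, p x y * p x' y ∂μ ∂μ := by
        rw [lintegral_add_left measurable_const, setLIntegral_const, mul_comm]
    _ ≤ _ := by
        gcongr
        rw [lintegral_lintegral_swap hm2.aemeasurable]
        calc ∫⁻ y, ∫⁻ x in S, p x y * p x' y ∂μ ∂μ ≤ ∫⁻ y, A * p x' y ∂μ := by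
              refine lintegral_mono_ae ?_
              filter_upwards [hpA] with y hy
              rw [lintegral_mul_const _ (hpy y)]
              gcongr
              refine (setLIntegral_le_lintegral S _).trans ?_
              simpa only [hsym _ y] using hy
          _ = A * ∫⁻ y, p x' y ∂μ := lintegral_const_mul _ (hpx x')
          _ ≤ A * A := by gcongr

/-- The Gram kernel of a pair of kernels. -/
noncomputable def gramKernel (μ : Measure X) (k l : X → X → ENNReal) (x x' : X) : ENNReal :=
  ∫⁻ y, k x y * k x' y ∂μ + ∫⁻ y, l x y * l x' y ∂μ

theorem gramKernel_comm (k l : X → X → ENNReal) (x x' : X) :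
    gramKernel μ k l x x' = gramKernel μ k l x' x := by
  simp only [gramKernel, mul_comm]

theorem measurable_mul_kernel {k : X → X → ENNReal} (hk : Measurable k.uncurry) :
    Measurable (fun z : (X × X) × X => k z.1.1 z.2 * k z.1.2 z.2) := by
  have h1 : Measurable (fun z : (X × X) × X => k z.1.1 z.2) :=
    hk.comp ((measurable_fst.comp measurable_fst).prodMk measurable_snd)
  have h2 : Measurable (fun z : (X × X) × X => k z.1.2 z.2) :=
    hk.comp ((measurable_snd.comp measurable_fst).prodMk measurable_snd)
  exact h1.mul h2

theorem measurable_gramKernel [SFinite μ] {k l : X → X → ENNReal} (hk : Measurable k.uncurry)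
    (hl : Measurable l.uncurry) : Measurable (gramKernel μ k l).uncurry :=
  (measurable_mul_kernel hk).lintegral_prod_right'.add
    (measurable_mul_kernel hl).lintegral_prod_right'

theorem lintegral_sq_kernel_eq [SFinite μ] {ν : Measure X} [SFinite ν] {k : X → X → ENNReal}
    (hk : Measurable k.uncurry) :
    ∫⁻ y, (∫⁻ x, k x y ∂ν) ^ 2 ∂μ = ∫⁻ x', ∫⁻ x, ∫⁻ y, k x y * k x' y ∂μ ∂ν ∂ν := by
  have hky : ∀ y, Measurable (fun x => k x y) := fun y => hk.of_uncurry_right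
  have h3 := measurable_mul_kernel hk
  calc ∫⁻ y, (∫⁻ x, k x y ∂ν) ^ 2 ∂μ
      = ∫⁻ y, ∫⁻ x', ∫⁻ x, k x y * k x' y ∂ν ∂ν ∂μ := by
        refine lintegral_congr fun y => ?_
        rw [sq, ← lintegral_const_mul _ (hky y)]
        refine lintegral_congr fun x' => ?_
        rw [← lintegral_mul_const _ (hky y)]
    _ = ∫⁻ x', ∫⁻ y, ∫⁻ x, k x y * k x' y ∂ν ∂μ ∂ν := by
        apply lintegral_lintegral_swap
        apply Measurable.aemeasurable
        have : Measurable (fun z : (X × X) × X => k z.2 z.1.1 * k z.1.2 z.1.1) :=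
          h3.comp ((measurable_snd.prodMk (measurable_snd.comp measurable_fst)).prodMk
            (measurable_fst.comp measurable_fst))
        exact this.lintegral_prod_right'
    _ = _ := by
        refine lintegral_congr fun x' => ?_
        apply lintegral_lintegral_swap
        apply Measurable.aemeasurable
        exact h3.comp ((measurable_snd.prodMk measurable_const).prodMk measurable_fst)

/-- Duality estimate for functions represented by a pair of kernels. -/
theorem sq_lintegral_le_gramKernel [SFinite μ] {ν : Measure X} [SFinite ν]
    {k l : X → X → ENNReal} (hk : Measurable k.uncurry) (hl : Measurable l.uncurry)
    {Φ a b : X → ENNReal} (ha : Measurable a) (hb : Measurable b)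
    (hΦ : ∀ᵐ x ∂ν, Φ x ≤ ∫⁻ y, k x y * a y ∂μ + ∫⁻ y, l x y * b y ∂μ)
    (hab : ∫⁻ y, a y ^ 2 ∂μ + ∫⁻ y, b y ^ 2 ∂μ ≤ 1) :
    (∫⁻ x, Φ x ∂ν) ^ 2 ≤ ∫⁻ x', ∫⁻ x, gramKernel μ k l x x' ∂ν ∂ν := by
  set Q := ∫⁻ x', ∫⁻ x, gramKernel μ k l x x' ∂ν ∂ν with hQ
  rcases eq_or_ne Q ⊤ with hQt | hQt
  · rw [hQt]; exact le_top
  have hkG : ∀ {k : X → X → ENNReal}, Measurable k.uncurry →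
      Measurable (fun y => ∫⁻ x, k x y ∂ν) := fun hk => by
    exact (hk.comp measurable_swap).lintegral_prod_right'
  have hQe : Q = ∫⁻ y, (∫⁻ x, k x y ∂ν) ^ 2 ∂μ + ∫⁻ y, (∫⁻ x, l x y ∂ν) ^ 2 ∂μ := by
    rw [lintegral_sq_kernel_eq hk, lintegral_sq_kernel_eq hl, hQ, ← lintegral_add_left]
    · refine lintegral_congr fun x' => ?_
      rw [← lintegral_add_left]
      · rfl
      · exact ((measurable_mul_kernel hk).lintegral_prod_right').comp
          (measurable_id.prodMk measurable_const)
    · have : Measurable (fun z : X × X => ∫⁻ y, k z.2 y * k z.1 y ∂μ) :=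
        ((measurable_mul_kernel hk).lintegral_prod_right').comp measurable_swap
      exact this.lintegral_prod_right'
  have hswap : ∀ {k : X → X → ENNReal} {a : X → ENNReal}, Measurable k.uncurry → Measurable a →
      ∫⁻ x, ∫⁻ y, k x y * a y ∂μ ∂ν = ∫⁻ y, a y * ∫⁻ x, k x y ∂ν ∂μ := fun {k a} hk ha => by
    rw [lintegral_lintegral_swap (hk.mul (ha.comp measurable_snd)).aemeasurable]
    refine lintegral_congr fun y => ?_
    rw [lintegral_mul_const _ hk.of_uncurry_right, mul_comm]
  have hT : ∫⁻ x, Φ x ∂ν ≤ ∫⁻ y, a y * ∫⁻ x, k x y ∂ν ∂μ + ∫⁻ y, b y * ∫⁻ x, l x y ∂ν ∂μ := by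
    rw [← hswap hk ha, ← hswap hl hb, ← lintegral_add_left]
    · exact lintegral_mono_ae hΦ
    · exact (hk.mul (ha.comp measurable_snd)).lintegral_prod_right'
  have hθ : ∀ θ : ℝ, 0 < θ → ∫⁻ x, Φ x ∂ν ≤
      ENNReal.ofReal (θ / 2) + ENNReal.ofReal (1 / (2 * θ)) * Q := by
    intro θ hθ
    have h1 : ∀ {k : X → X → ENNReal} {a : X → ENNReal}, Measurable k.uncurry → Measurable a →
        ∫⁻ y, a y * ∫⁻ x, k x y ∂ν ∂μ ≤ ENNReal.ofReal (θ / 2) * ∫⁻ y, a y ^ 2 ∂μ +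
          ENNReal.ofReal (1 / (2 * θ)) * ∫⁻ y, (∫⁻ x, k x y ∂ν) ^ 2 ∂μ := fun {k a} hk ha => by
      rw [← lintegral_const_mul _ (by fun_prop), ← lintegral_const_mul _ ((hkG hk).pow_const 2),
        ← lintegral_add_left (by fun_prop)]
      exact lintegral_mono fun y => ENNReal.mul_le_half_sq_add_sq _ _ hθ
    calc _ ≤ _ := hT.trans (add_le_add (h1 hk ha) (h1 hl hb))
      _ = ENNReal.ofReal (θ / 2) * (∫⁻ y, a y ^ 2 ∂μ + ∫⁻ y, b y ^ 2 ∂μ) +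
          ENNReal.ofReal (1 / (2 * θ)) * Q := by rw [hQe]; ring
      _ ≤ ENNReal.ofReal (θ / 2) * 1 + ENNReal.ofReal (1 / (2 * θ)) * Q := by gcongr
      _ = _ := by rw [mul_one]
  set T := ∫⁻ x, Φ x ∂ν
  have hTt : T ≠ ⊤ := ne_top_of_le_ne_top
    (ENNReal.add_ne_top.2 ⟨ENNReal.ofReal_ne_top, ENNReal.mul_ne_top ENNReal.ofReal_ne_top hQt⟩)
    (hθ 1 one_pos)
  lift T to NNReal using hTt with t
  lift Q to NNReal using hQt with q
  rcases eq_or_ne t 0 with rfl | ht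
  · simp
  have ht0 : 0 < (t : ℝ) := by exact_mod_cast pos_iff_ne_zero.2 ht
  have h := hθ t ht0
  rw [← ENNReal.ofReal_coe_nnreal (p := q), ← ENNReal.ofReal_mul (by positivity),
    ← ENNReal.ofReal_add (by positivity) (by positivity), ← ENNReal.ofReal_coe_nnreal (p := t),
    ENNReal.ofReal_le_ofReal_iff (by positivity)] at h
  have h2 : (t : ℝ) ^ 2 ≤ q := by
    have h3 : 1 / (2 * (t : ℝ)) * q = q / (2 * t) := by ring
    rw [h3] at h
    have h4 : (t : ℝ) / 2 ≤ q / (2 * t) := by linarith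
    rw [le_div_iff₀ (by positivity)] at h4
    nlinarith
  exact_mod_cast h2

theorem sq_add_le_of_gramKernel [SFinite μ] {k l : X → X → ENNReal} (hk : Measurable k.uncurry)
    (hl : Measurable l.uncurry) {Φ a b : X → ENNReal} (ha : Measurable a) (hb : Measurable b)
    (hΦ : ∀ᵐ x ∂μ, Φ x ≤ ∫⁻ y, k x y * a y ∂μ + ∫⁻ y, l x y * b y ∂μ)
    (hab : ∫⁻ y, a y ^ 2 ∂μ + ∫⁻ y, b y ^ 2 ∂μ ≤ 1) {S₁ S₂ : Set X} {s₁ s₂ J₁ J₂ : ENNReal}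
    (hS₁ : MeasurableSet S₁) (hS₂ : MeasurableSet S₂)
    (h1 : μ S₁ ≠ 0) (h1' : μ S₁ ≠ ⊤) (h2 : μ S₂ ≠ 0) (h2' : μ S₂ ≠ ⊤)
    (hs1 : ∀ x ∈ S₁, s₁ ≤ Φ x) (hs2 : ∀ x ∈ S₂, s₂ ≤ Φ x)
    (hJ1 : ∀ᵐ x' ∂μ, ∫⁻ x in S₁, gramKernel μ k l x x' ∂μ ≤ μ S₁ * J₁)
    (hJ2 : ∀ᵐ x' ∂μ, ∫⁻ x in S₂, gramKernel μ k l x x' ∂μ ≤ μ S₂ * J₂) :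
    (s₁ + s₂) ^ 2 ≤ 3 * J₁ + J₂ := by
  set c₁ := (μ S₁)⁻¹
  set c₂ := (μ S₂)⁻¹
  have e1 : c₁ * μ S₁ = 1 := ENNReal.inv_mul_cancel h1 h1'
  have e2 : c₂ * μ S₂ = 1 := ENNReal.inv_mul_cancel h2 h2'
  set ν : Measure X := c₁ • μ.restrict S₁ + c₂ • μ.restrict S₂ with hν
  have hνμ : ν ≪ μ := by
    refine Measure.AbsolutelyContinuous.add_left ?_ ?_ <;>
      exact Measure.restrict_le_self.absolutelyContinuous.smul_left _
  have hG := measurable_gramKernel (μ := μ) hk hl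
  have hF : ∀ S : Set X, Measurable (fun x' => ∫⁻ x in S, gramKernel μ k l x x' ∂μ) := fun S =>
    (hG.comp measurable_swap).lintegral_prod_right'
  have hlow : s₁ + s₂ ≤ ∫⁻ x, Φ x ∂ν := by
    rw [hν, lintegral_add_measure, lintegral_smul_measure, lintegral_smul_measure]
    have : ∀ {S : Set X} {s : ENNReal}, MeasurableSet S → μ S ≠ 0 → μ S ≠ ⊤ →
        (∀ x ∈ S, s ≤ Φ x) → s ≤ (μ S)⁻¹ • ∫⁻ x in S, Φ x ∂μ := fun {S s} hS h0 ht hs => by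
      calc s = (μ S)⁻¹ * (s * μ S) := by
            rw [mul_comm s, ← mul_assoc, ENNReal.inv_mul_cancel h0 ht, one_mul]
        _ ≤ _ := by
            rw [smul_eq_mul, ← setLIntegral_const]
            gcongr 1
            exact setLIntegral_mono' hS hs
    exact add_le_add (this hS₁ h1 h1' hs1) (this hS₂ h2 h2' hs2)
  refine (pow_le_pow_left' hlow 2).trans ((sq_lintegral_le_gramKernel hk hl ha hb
    (hνμ.ae_le hΦ) hab).trans ?_)
  have hsplit : ∀ f : X → ENNReal, ∫⁻ x, f x ∂ν =
      c₁ * ∫⁻ x in S₁, f x ∂μ + c₂ * ∫⁻ x in S₂, f x ∂μ := fun f => by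
    rw [hν, lintegral_add_measure, lintegral_smul_measure, lintegral_smul_measure]; rfl
  have hbd : ∀ {S T : Set X} {J : ENNReal},
      (∀ᵐ x' ∂μ, ∫⁻ x in S, gramKernel μ k l x x' ∂μ ≤ μ S * J) →
      ∫⁻ x' in T, ∫⁻ x in S, gramKernel μ k l x x' ∂μ ∂μ ≤ μ T * (μ S * J) := fun {S T J} h => by
    calc _ ≤ ∫⁻ x' in T, μ S * J ∂μ := lintegral_mono_ae (ae_restrict_of_ae h)
      _ = _ := by rw [setLIntegral_const, mul_comm]
  have hsw : ∫⁻ x' in S₁, ∫⁻ x in S₂, gramKernel μ k l x x' ∂μ ∂μ =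
      ∫⁻ x' in S₂, ∫⁻ x in S₁, gramKernel μ k l x x' ∂μ ∂μ := by
    rw [lintegral_lintegral_swap (f := fun x' x => gramKernel μ k l x x')
      (hG.comp measurable_swap).aemeasurable]
    simp only [gramKernel_comm (μ := μ) k l]
  simp only [hsplit]
  rw [lintegral_add_left ((hF S₁).const_mul _), lintegral_add_left ((hF S₁).const_mul _),
    lintegral_const_mul _ (hF S₁), lintegral_const_mul _ (hF S₂), lintegral_const_mul _ (hF S₁),
    lintegral_const_mul _ (hF S₂), hsw]
  calc _ ≤ c₁ * (c₁ * (μ S₁ * (μ S₁ * J₁)) + c₂ * (μ S₂ * (μ S₁ * J₁))) +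
        c₂ * (c₁ * (μ S₂ * (μ S₁ * J₁)) + c₂ * (μ S₂ * (μ S₂ * J₂))) := by
        gcongr
        exacts [hbd hJ1, hbd hJ1, hbd hJ1, hbd hJ2]
    _ = (c₁ * μ S₁) * (c₁ * μ S₁) * J₁ + (c₂ * μ S₂) * (c₁ * μ S₁) * J₁ +
        ((c₂ * μ S₂) * (c₁ * μ S₁) * J₁ + (c₂ * μ S₂) * (c₂ * μ S₂) * J₂) := by ring
    _ = _ := by rw [e1, e2]; ring

end Abstract

theorem log_distribution_le {X : Type*} [MeasurableSpace X] {μ : Measure X} [SFinite μ]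
    {k l : X → X → ENNReal} (hk : Measurable k.uncurry) (hl : Measurable l.uncurry)
    {M C γ β : ℝ} (hM : 0 < M) (hC : 0 ≤ C) (hγ : 0 < γ) (hγβ : γ ^ 2 = β * M)
    (hW : ∀ S : Set X, MeasurableSet S → μ S ≠ 0 → μ S ≤ ENNReal.ofReal (1 / 16) →
      ∀ᵐ x' ∂μ, ∫⁻ x in S, gramKernel μ k l x x' ∂μ ≤
        μ S * ENNReal.ofReal (M * log (1 / (μ S).toReal) + C))
    {v : X → ℝ} (hv : Measurable v) {a b : X → ENNReal} (ha : Measurable a) (hb : Measurable b)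
    (hΦ : ∀ᵐ x ∂μ, ENNReal.ofReal (γ * v x) ≤ ∫⁻ y, k x y * a y ∂μ + ∫⁻ y, l x y * b y ∂μ)
    (hab : ∫⁻ y, a y ^ 2 ∂μ + ∫⁻ y, b y ^ 2 ∂μ ≤ 1) {s t : ℝ} (hs : 0 ≤ s) (ht : 0 ≤ t)
    (hs' : μ {x | s < v x} ≤ ENNReal.ofReal (1 / 16))
    (ht' : μ {x | t < v x} ≤ ENNReal.ofReal (1 / 16))
    (hs0 : 0 < (μ {x | s < v x}).toReal) (ht0 : 0 < (μ {x | t < v x}).toReal) :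
    β * (s + t) ^ 2 ≤ 3 * log (1 / (μ {x | s < v x}).toReal) +
      log (1 / (μ {x | t < v x}).toReal) + 4 * C / M := by
  have hS : ∀ r : ℝ, MeasurableSet {x | r < v x} := fun r => measurableSet_lt measurable_const hv
  have hlog : ∀ {r : ℝ}, μ {x | r < v x} ≤ ENNReal.ofReal (1 / 16) →
      0 < (μ {x | r < v x}).toReal → 0 ≤ log (1 / (μ {x | r < v x}).toReal) := fun {r} h h0 => by
    have : (μ {x | r < v x}).toReal ≤ 1 / 16 := ENNReal.toReal_le_of_le_ofReal (by norm_num) h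
    exact log_nonneg ((one_le_div h0).2 (by linarith))
  have hl1 := hlog hs' hs0
  have hl2 := hlog ht' ht0
  have ne0 := (ENNReal.toReal_pos_iff.1 hs0)
  have ne1 := (ENNReal.toReal_pos_iff.1 ht0)
  have hΦS : ∀ r : ℝ, ∀ x ∈ {x | r < v x}, ENNReal.ofReal (γ * r) ≤ ENNReal.ofReal (γ * v x) :=
    fun r x hx => ENNReal.ofReal_le_ofReal (mul_le_mul_of_nonneg_left (le_of_lt hx) hγ.le)
  have h := sq_add_le_of_gramKernel hk hl ha hb hΦ hab (hS s) (hS t) ne0.1.ne' ne0.2.ne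
    ne1.1.ne' ne1.2.ne (hΦS s) (hΦS t) (hW _ (hS s) ne0.1.ne' hs') (hW _ (hS t) ne1.1.ne' ht')
  set L₁ := log (1 / (μ {x | s < v x}).toReal)
  set L₂ := log (1 / (μ {x | t < v x}).toReal)
  rw [← ENNReal.ofReal_add (by positivity) (by positivity), ← ENNReal.ofReal_pow (by positivity),
    show (3 : ENNReal) = ENNReal.ofReal 3 by simp, ← ENNReal.ofReal_mul (by norm_num),
    ← ENNReal.ofReal_add (by positivity) (by positivity),
    ENNReal.ofReal_le_ofReal_iff (by positivity)] at h
  have h3 : β * M * (s + t) ^ 2 ≤ 3 * (M * L₁ + C) + (M * L₂ + C) := by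
    rw [← hγβ]; nlinarith [h]
  have h4 : (β * (s + t) ^ 2) * M ≤ (3 * L₁ + L₂ + 4 * C / M) * M := by
    have : 4 * C / M * M = 4 * C := by field_simp
    nlinarith
  exact le_of_mul_le_mul_right h4 hM

theorem lintegral_exp_sub_one_eq {X : Type*} [MeasurableSpace X] {μ : Measure X} [SFinite μ]
    {v : X → ℝ} (hv : Measurable v) (hv0 : ∀ x, 0 ≤ v x) {β : ℝ} (hβ : 0 < β) :
    ∫⁻ x, ENNReal.ofReal (rexp (β * v x ^ 2) - 1) ∂μ =
      ∫⁻ t in Set.Ioi 0, μ {x | t < v x} * ENNReal.ofReal (2 * β * t * rexp (β * t ^ 2)) := by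
  rw [← lintegral_comp_eq_lintegral_meas_lt_mul μ (Filter.Eventually.of_forall hv0)
    hv.aemeasurable (g := fun t => 2 * β * t * rexp (β * t ^ 2))]
  · refine lintegral_congr fun x => ?_
    rw [intervalIntegral.integral_eq_sub_of_hasDerivAt (f := fun t => rexp (β * t ^ 2))]
    · simp
    · intro t _
      exact (((hasDerivAt_pow 2 t).const_mul β).exp).congr_deriv (by norm_num; ring)
    · exact Continuous.intervalIntegrable (by fun_prop) _ _
  · intro t _
    exact Continuous.intervalIntegrable (by fun_prop) _ _
  · filter_upwards [ae_restrict_mem measurableSet_Ioi] with t ht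
    have : 0 < t := ht
    positivity

theorem lintegral_sq_eq {X : Type*} [MeasurableSpace X] {μ : Measure X} [SFinite μ]
    {v : X → ℝ} (hv : Measurable v) (hv0 : ∀ x, 0 ≤ v x) :
    ∫⁻ x, ENNReal.ofReal (v x ^ 2) ∂μ =
      ∫⁻ t in Set.Ioi 0, μ {x | t < v x} * ENNReal.ofReal (2 * t) := by
  rw [← lintegral_comp_eq_lintegral_meas_lt_mul μ (Filter.Eventually.of_forall hv0)
    hv.aemeasurable (g := fun t => 2 * t)]
  · refine lintegral_congr fun x => ?_
    rw [intervalIntegral.integral_eq_sub_of_hasDerivAt (f := fun t => t ^ 2)]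
    · simp
    · intro t _
      exact (hasDerivAt_pow 2 t).congr_deriv (by norm_num)
    · exact Continuous.intervalIntegrable (by fun_prop) _ _
  · intro t _
    exact Continuous.intervalIntegrable (by fun_prop) _ _
  · filter_upwards [ae_restrict_mem measurableSet_Ioi] with t ht
    have : 0 < t := ht
    positivity

/-- Exponential integrability for functions represented by a pair of kernels whose Gram kernel has
logarithmic averages. -/
theorem exists_lintegral_exp_sub_one_le {X : Type*} [MeasurableSpace X] {μ : Measure X} [SFinite μ]
    {k l : X → X → ENNReal} (hk : Measurable k.uncurry) (hl : Measurable l.uncurry)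
    {M C γ β V : ℝ} (hM : 0 < M) (hC : 0 ≤ C) (hγ : 0 < γ) (hβ : 0 < β) (hγβ : γ ^ 2 = β * M)
    (hV : 0 ≤ V)
    (hW : ∀ S : Set X, MeasurableSet S → μ S ≠ 0 → μ S ≤ ENNReal.ofReal (1 / 16) →
      ∀ᵐ x' ∂μ, ∫⁻ x in S, gramKernel μ k l x x' ∂μ ≤
        μ S * ENNReal.ofReal (M * log (1 / (μ S).toReal) + C)) :
    ∃ K : ℝ, ∀ (v : X → ℝ) (a b : X → ENNReal), Measurable v → (∀ x, 0 ≤ v x) → Measurable a →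
      Measurable b →
      (∀ᵐ x ∂μ, ENNReal.ofReal (γ * v x) ≤ ∫⁻ y, k x y * a y ∂μ + ∫⁻ y, l x y * b y ∂μ) →
      ∫⁻ y, a y ^ 2 ∂μ + ∫⁻ y, b y ^ 2 ∂μ ≤ 1 →
      ∫⁻ x, ENNReal.ofReal (v x ^ 2) ∂μ ≤ ENNReal.ofReal V →
      ∫⁻ x, ENNReal.ofReal (rexp (β * v x ^ 2) - 1) ∂μ ≤ ENNReal.ofReal K := by
  set s₀ : ℝ := max 1 (4 * √V) with hs₀
  have hs1 : 1 ≤ s₀ := le_max_left _ _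
  have hs0 : 0 < s₀ := by linarith
  refine ⟨β * rexp (β * s₀ ^ 2) * V + rexp ((4 * C / M + 3) / 4) * (14 + 8 / β), ?_⟩
  intro v a b hv hv0 ha hb hΦ hab hvV
  have hmark : ∀ s, s₀ ≤ s → μ {x | s < v x} ≤ ENNReal.ofReal (1 / 16) := by
    intro s hs
    have h1 : ENNReal.ofReal (s₀ ^ 2) * μ {x | s < v x} ≤ ENNReal.ofReal V := by
      refine le_trans ?_ ((mul_meas_ge_le_lintegral (μ := μ)
        ((hv.pow_const 2).ennreal_ofReal) (ENNReal.ofReal (s₀ ^ 2))).trans hvV)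
      gcongr
      intro hx
      have hx' : s < v x := hx
      exact ENNReal.ofReal_le_ofReal (by gcongr; linarith)
    have h2 : ENNReal.ofReal V ≤ ENNReal.ofReal (s₀ ^ 2) * ENNReal.ofReal (1 / 16) := by
      rw [← ENNReal.ofReal_mul (by positivity)]
      apply ENNReal.ofReal_le_ofReal
      have h3 : 4 * √V ≤ s₀ := le_max_right _ _
      have h4 := Real.sq_sqrt hV
      nlinarith [Real.sqrt_nonneg V]
    exact (ENNReal.mul_le_mul_iff_right (by simpa using hs0.ne') ENNReal.ofReal_ne_top).1
      (h1.trans h2)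
  have hfin : ∀ s, s₀ ≤ s → μ {x | s < v x} ≠ ⊤ := fun s hs =>
    ne_top_of_le_ne_top ENNReal.ofReal_ne_top (hmark s hs)
  rw [lintegral_exp_sub_one_eq hv hv0 hβ, ← Set.Ioc_union_Ioi_eq_Ioi hs0.le,
    lintegral_union measurableSet_Ioi (Set.Ioc_disjoint_Ioi le_rfl),
    ENNReal.ofReal_add (by positivity) (by positivity)]
  refine add_le_add ?_ ?_
  · calc ∫⁻ t in Set.Ioc 0 s₀, μ {x | t < v x} * ENNReal.ofReal (2 * β * t * rexp (β * t ^ 2))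
        ≤ ∫⁻ t in Set.Ioc 0 s₀, ENNReal.ofReal (β * rexp (β * s₀ ^ 2)) *
            (μ {x | t < v x} * ENNReal.ofReal (2 * t)) := by
          refine setLIntegral_mono' measurableSet_Ioc fun t ht => ?_
          have ht0 : 0 < t := ht.1
          rw [mul_left_comm, ← ENNReal.ofReal_mul (by positivity)]
          refine mul_le_mul_right (ENNReal.ofReal_le_ofReal ?_) _
          have h5 : rexp (β * t ^ 2) ≤ rexp (β * s₀ ^ 2) := by
            apply Real.exp_le_exp.2
            have := ht.2
            gcongr
          have : 0 ≤ 2 * β * t := by positivity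
          nlinarith
      _ ≤ ∫⁻ t in Set.Ioi 0, ENNReal.ofReal (β * rexp (β * s₀ ^ 2)) *
            (μ {x | t < v x} * ENNReal.ofReal (2 * t)) :=
          lintegral_mono_set Set.Ioc_subset_Ioi_self
      _ = ENNReal.ofReal (β * rexp (β * s₀ ^ 2)) * ∫⁻ x, ENNReal.ofReal (v x ^ 2) ∂μ := by
          rw [lintegral_const_mul' _ _ ENNReal.ofReal_ne_top, lintegral_sq_eq hv hv0]
      _ ≤ ENNReal.ofReal (β * rexp (β * s₀ ^ 2)) * ENNReal.ofReal V := by gcongr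
      _ = _ := by rw [← ENNReal.ofReal_mul (by positivity)]
  · refine le_trans (le_of_eq ?_) (lintegral_distribution_le (C := 4 * C / M) hβ hs1
      (m := fun s => (μ {x | s < v x}).toReal) (fun s => ENNReal.toReal_nonneg) ?_)
    · refine setLIntegral_congr_fun measurableSet_Ioi fun t ht => ?_
      have ht1 : s₀ < t := ht
      have ht0 : 0 < t := hs0.trans ht1
      rw [ENNReal.ofReal_mul (p := 2 * β * t * rexp (β * t ^ 2)) (by positivity),
        ENNReal.ofReal_toReal (hfin t ht1.le), mul_comm]
    · intro s t hs hst h1 h2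
      exact log_distribution_le hk hl hM hC hγ hγβ hW hv ha hb hΦ hab (by linarith) (by linarith)
        (hmark s hs) (hmark t (hs.trans hst)) h1 h2

noncomputable section

/-- The `i`-th partial derivative. -/
def pderivE (u : E4 → ℝ) (i : Fin 4) (x : E4) : ℝ := fderiv ℝ u x (EuclideanSpace.single i 1)

/-- The defining function `1 - |x|²` of the unit ball. -/
def ballWeight (x : E4) : ℝ := 1 - ‖x‖ ^ 2

theorem lapE_eq_sum (u : E4 → ℝ) (x : E4) : lapE u x = ∑ i, pderivE (pderivE u i) i x := rfl

theorem hasDerivAt_pderivE {u : E4 → ℝ} {x : E4} (hu : DifferentiableAt ℝ u x) (i : Fin 4) :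
    HasDerivAt (fun t : ℝ => u (x + t • EuclideanSpace.single i 1)) (pderivE u i x) 0 :=
  hu.hasFDerivAt.hasLineDerivAt _

theorem pderivE_eq_of_hasDerivAt {u : E4 → ℝ} {x : E4} (hu : DifferentiableAt ℝ u x) {i : Fin 4}
    {d : ℝ} (h : HasDerivAt (fun t : ℝ => u (x + t • EuclideanSpace.single i 1)) d 0) :
    pderivE u i x = d :=
  (hasDerivAt_pderivE hu i).unique h

theorem contDiff_pderivE {u : E4 → ℝ} {n m : WithTop ℕ∞} (hu : ContDiff ℝ n u) (hmn : m + 1 ≤ n)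
    (i : Fin 4) : ContDiff ℝ m (pderivE u i) :=
  (hu.fderiv_right hmn).clm_apply contDiff_const

theorem tsupport_pderivE_subset (u : E4 → ℝ) (i : Fin 4) :
    tsupport (pderivE u i) ⊆ tsupport u := tsupport_fderiv_apply_subset ℝ _

theorem pderivE_eq_zero {u : E4 → ℝ} {x : E4} (hx : x ∉ tsupport u) (i : Fin 4) :
    pderivE u i x = 0 :=
  image_eq_zero_of_notMem_tsupport fun h => hx (tsupport_pderivE_subset u i h)

theorem pderivE_comm {u : E4 → ℝ} (hu : ContDiff ℝ 2 u) (i j : Fin 4) (x : E4) :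
    pderivE (pderivE u i) j x = pderivE (pderivE u j) i x := by
  have hd : DifferentiableAt ℝ (fderiv ℝ u) x :=
    (hu.fderiv_right (m := 1) (by norm_num)).differentiable (by norm_num) x
  have h : ∀ i j, pderivE (pderivE u i) j x =
      fderiv ℝ (fderiv ℝ u) x (EuclideanSpace.single j 1) (EuclideanSpace.single i 1) := by
    intro i j
    unfold pderivE
    rw [fderiv_clm_apply hd (differentiableAt_const _)]
    simp
  rw [h, h]
  exact (hu.contDiffAt.isSymmSndFDerivAt (by simp)).eq _ _

theorem contDiff_ballWeight {n : WithTop ℕ∞} : ContDiff ℝ n ballWeight :=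
  contDiff_const.sub (contDiff_norm_sq ℝ)

theorem ballWeight_pos {x : E4} (hx : x ∈ Metric.ball (0 : E4) 1) : 0 < ballWeight x := by
  have : ‖x‖ < 1 := by simpa using hx
  have := norm_nonneg x
  unfold ballWeight
  nlinarith

theorem ballWeight_eq (x : E4) : ballWeight x = 1 - ∑ i, x i ^ 2 := by
  rw [ballWeight, EuclideanSpace.real_norm_sq_eq]

theorem hasDerivAt_coord (x : E4) (i j : Fin 4) :
    HasDerivAt (fun t : ℝ => (x + t • EuclideanSpace.single i (1 : ℝ)) j)
      (if j = i then 1 else 0) 0 := by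
  have h := ((hasDerivAt_id' (0 : ℝ)).mul_const (if j = i then (1 : ℝ) else 0)).const_add (x j)
  refine (h.congr_deriv (by simp)).congr_of_eventuallyEq (Filter.Eventually.of_forall fun t => ?_)
  simp

theorem hasDerivAt_ballWeight (x : E4) (i : Fin 4) :
    HasDerivAt (fun t : ℝ => ballWeight (x + t • EuclideanSpace.single i (1 : ℝ)))
      (-2 * x i) 0 := by
  simp only [ballWeight_eq]
  refine ((HasDerivAt.fun_sum (u := Finset.univ) fun j _ =>
    (hasDerivAt_coord x i j).fun_pow 2).const_sub 1).congr_deriv ?_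
  simp

theorem contDiff_mul_of_tsupport_subset {φ ρ : E4 → ℝ} {n : WithTop ℕ∞} {s : Set E4}
    (hs : IsOpen s) (hφ : ContDiff ℝ n φ) (hsup : tsupport φ ⊆ s) (hρ : ContDiffOn ℝ n ρ s) :
    ContDiff ℝ n (fun x => φ x * ρ x) := by
  rw [contDiff_iff_contDiffAt]
  intro x
  by_cases hx : x ∈ tsupport φ
  · exact hφ.contDiffAt.mul (hρ.contDiffAt (hs.mem_nhds (hsup hx)))
  · have : (fun x => φ x * ρ x) =ᶠ[nhds x] fun _ => 0 := by
      filter_upwards [notMem_tsupport_iff_eventuallyEq.1 hx] with y hy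
      simp [hy]
    exact contDiffAt_const.congr_of_eventuallyEq this

theorem contDiffOn_ballWeight_inv_pow {n : WithTop ℕ∞} (m : ℕ) :
    ContDiffOn ℝ n (fun x : E4 => (ballWeight x)⁻¹ ^ m) (Metric.ball 0 1) :=
  (contDiff_ballWeight.contDiffOn.inv fun _ hx => (ballWeight_pos hx).ne').pow m

theorem contDiff_mul_ballWeight_inv_pow {φ : E4 → ℝ} {n : WithTop ℕ∞} (hφ : ContDiff ℝ n φ)
    (hsup : tsupport φ ⊆ Metric.ball 0 1) (m : ℕ) :
    ContDiff ℝ n (fun x => φ x * (ballWeight x)⁻¹ ^ m) :=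
  contDiff_mul_of_tsupport_subset Metric.isOpen_ball hφ hsup (contDiffOn_ballWeight_inv_pow m)

theorem integral_pderivE_eq_zero {X : E4 → ℝ} (hX : ContDiff ℝ 1 X) (hc : HasCompactSupport X)
    (i : Fin 4) : ∫ x, pderivE X i x = 0 := by
  have h1 : Continuous (pderivE X i) := (contDiff_pderivE (m := 0) hX (by norm_num) i).continuous
  have h2 : HasCompactSupport (pderivE X i) := hc.fderiv_apply ℝ _
  have := integral_mul_fderiv_eq_neg_fderiv_mul_of_integrable (μ := volume) (f := fun _ : E4 => (1 : ℝ))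
    (g := X) (v := EuclideanSpace.single i 1) (by simp)
    (by simp only [one_mul]; exact h1.integrable_of_hasCompactSupport h2)
    (by simpa using hX.continuous.integrable_of_hasCompactSupport hc)
    (fun _ _ => differentiableAt_const _) (fun _ _ => hX.differentiable (by norm_num) _)
  simpa [pderivE] using this

/-- The first order completion `Δu + 4 x·∇u / w + 9 u / w²` of the Laplacian, `w = 1 - |x|²`. -/
def adamsField (u : E4 → ℝ) (x : E4) : ℝ :=
  lapE u x + 4 * (∑ i, x i * pderivE u i x) * (ballWeight x)⁻¹ + 9 * u x * (ballWeight x)⁻¹ ^ 2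

/-- The vector field whose divergence relates `|Δu|²` and the square of `adamsField u`. -/
def energyField (u : E4 → ℝ) (i : Fin 4) (x : E4) : ℝ :=
  -8 * (pderivE u i x * (∑ j, x j * pderivE u j x) * (ballWeight x)⁻¹ ^ 1
    - 1 / 2 * ((∑ j, pderivE u j x ^ 2) * x i * (ballWeight x)⁻¹ ^ 1))
    - 18 * (u x * pderivE u i x * (ballWeight x)⁻¹ ^ 2)
    - 30 * (u x ^ 2 * x i * (ballWeight x)⁻¹ ^ 3)

theorem pderivE_energyField {u : E4 → ℝ} (hu : ContDiff ℝ 2 u) {x : E4}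
    (hx : x ∈ Metric.ball (0 : E4) 1) (i : Fin 4) (hd : DifferentiableAt ℝ (energyField u i) x) :
    pderivE (energyField u i) i x =
      let p := fun j => pderivE u j x
      let H := fun i j => pderivE (pderivE u i) j x
      let ω := (ballWeight x)⁻¹;
      -8 * (H i i * (∑ j, x j * p j) * ω + p i * (p i + ∑ j, x j * H j i) * ω
        + p i * (∑ j, x j * p j) * (2 * x i * ω ^ 2)
        - ((∑ j, p j * H j i) * x i * ω + 1 / 2 * (∑ j, p j ^ 2) * ω
          + 1 / 2 * (∑ j, p j ^ 2) * x i * (2 * x i * ω ^ 2)))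
      - 18 * (p i ^ 2 * ω ^ 2 + u x * H i i * ω ^ 2 + u x * p i * (4 * x i * ω ^ 3))
      - 30 * (2 * u x * p i * x i * ω ^ 3 + u x ^ 2 * ω ^ 3 + u x ^ 2 * x i * (6 * x i * ω ^ 4)) := by
  have hw := (ballWeight_pos hx).ne'
  have hp : ∀ j, DifferentiableAt ℝ (pderivE u j) x := fun j =>
    (contDiff_pderivE (m := 1) hu (by norm_num) j).differentiable (by norm_num) x
  have h0 := hasDerivAt_pderivE (hu.differentiable (by norm_num) x) i
  have h1 := fun j => hasDerivAt_pderivE (hp j) i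
  have h2 := hasDerivAt_coord x i
  have h3 : HasDerivAt (fun t : ℝ => (ballWeight (x + t • EuclideanSpace.single i (1 : ℝ)))⁻¹)
      (2 * x i * (ballWeight x)⁻¹ ^ 2) 0 := by
    refine ((hasDerivAt_ballWeight x i).fun_inv (by simpa using hw)).congr_deriv ?_
    simp
    field_simp
  have hS := HasDerivAt.fun_sum (u := Finset.univ) fun j _ => (h2 j).fun_mul (h1 j)
  have hQ := HasDerivAt.fun_sum (u := Finset.univ) fun j _ => (h1 j).fun_pow 2
  have key := ((((((h1 i).fun_mul hS).fun_mul (h3.fun_pow 1)).fun_sub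
    (((hQ.fun_mul (h2 i)).fun_mul (h3.fun_pow 1)).const_mul (1 / 2))).const_mul (-8)).fun_sub
    (((h0.fun_mul (h1 i)).fun_mul (h3.fun_pow 2)).const_mul 18)).fun_sub
    ((((h0.fun_pow 2).fun_mul (h2 i)).fun_mul (h3.fun_pow 3)).const_mul 30)
  rw [pderivE_eq_of_hasDerivAt hd key]
  simp [Finset.sum_add_distrib]
  have e : ∑ j, 2 * pderivE u j x * pderivE (pderivE u j) i x =
    2 * ∑ j, pderivE u j x * pderivE (pderivE u j) i x := by
    rw [Finset.mul_sum]; exact Finset.sum_congr rfl fun j _ => by ring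
  rw [e]
  ring


theorem sum_sq_identity {p x : Fin 4 → ℝ} {H : Fin 4 → Fin 4 → ℝ} (hH : ∀ i j, H i j = H j i)
    {u ω : ℝ} (hω : (1 - ∑ i, x i ^ 2) * ω = 1) :
    (∑ i, H i i) ^ 2 = (∑ i, H i i + 4 * (∑ i, x i * p i) * ω + 9 * u * ω ^ 2) ^ 2
      + 9 * (u ^ 2 * ω ^ 4) + 10 * (∑ i, (p i + 3 * u * x i * ω) ^ 2) * ω ^ 2 + 30 * u ^ 2 * ω ^ 3 +
      ∑ i, (-8 * (H i i * (∑ j, x j * p j) * ω + p i * (p i + ∑ j, x j * H j i) * ω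
        + p i * (∑ j, x j * p j) * (2 * x i * ω ^ 2)
        - ((∑ j, p j * H j i) * x i * ω + 1 / 2 * (∑ j, p j ^ 2) * ω
          + 1 / 2 * (∑ j, p j ^ 2) * x i * (2 * x i * ω ^ 2)))
      - 18 * (p i ^ 2 * ω ^ 2 + u * H i i * ω ^ 2 + u * p i * (4 * x i * ω ^ 3))
      - 30 * (2 * u * p i * x i * ω ^ 3 + u ^ 2 * ω ^ 3 + u ^ 2 * x i * (6 * x i * ω ^ 4))) := by
  simp only [Fin.sum_univ_four] at hω ⊢
  rw [hH 1 0, hH 2 0, hH 3 0, hH 2 1, hH 3 1, hH 3 2]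
  linear_combination (8 * (p 0 ^ 2 + p 1 ^ 2 + p 2 ^ 2 + p 3 ^ 2) * ω - 90 * u ^ 2 * ω ^ 3) * hω

theorem contDiff_energyField {u : E4 → ℝ} (hu : ContDiff ℝ 2 u)
    (hs : tsupport u ⊆ Metric.ball (0 : E4) 1) (i : Fin 4) : ContDiff ℝ 1 (energyField u i) := by
  have hp : ∀ j, ContDiff ℝ 1 (pderivE u j) := fun j => contDiff_pderivE hu (by norm_num) j
  have hu1 : ContDiff ℝ 1 u := hu.of_le (by norm_num)
  have hx : ∀ j, ContDiff ℝ 1 fun x : E4 => x j := fun j => by fun_prop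
  have hps : ∀ j, tsupport (pderivE u j) ⊆ Metric.ball 0 1 := fun j =>
    (tsupport_pderivE_subset u j).trans hs
  unfold energyField
  refine ContDiff.sub (ContDiff.sub (contDiff_const.mul (ContDiff.sub ?_ (contDiff_const.mul ?_)))
    (contDiff_const.mul ?_)) (contDiff_const.mul ?_)
  · exact contDiff_mul_ballWeight_inv_pow ((hp i).mul (ContDiff.sum fun j _ => (hx j).mul (hp j)))
      ((tsupport_mul_subset_left).trans (hps i)) 1
  · have : ∀ j, ContDiff ℝ 1 fun x : E4 => pderivE u j x * (pderivE u j x * x i) *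
        (ballWeight x)⁻¹ ^ 1 := fun j =>
      contDiff_mul_ballWeight_inv_pow ((hp j).mul ((hp j).mul (hx i)))
        ((tsupport_mul_subset_left).trans (hps j)) 1
    have e : (fun x : E4 => (∑ j, pderivE u j x ^ 2) * x i * (ballWeight x)⁻¹ ^ 1) =
        fun x => ∑ j, pderivE u j x * (pderivE u j x * x i) * (ballWeight x)⁻¹ ^ 1 := by
      funext x
      rw [Finset.sum_mul, Finset.sum_mul]
      exact Finset.sum_congr rfl fun j _ => by ring
    rw [e]
    exact ContDiff.sum fun j _ => this j
  · exact contDiff_mul_ballWeight_inv_pow (hu1.mul (hp i))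
      ((tsupport_mul_subset_left).trans hs) 2
  · have e : (fun x : E4 => u x ^ 2 * x i * (ballWeight x)⁻¹ ^ 3) =
        fun x => u x * (u x * x i) * (ballWeight x)⁻¹ ^ 3 := by
      funext x
      ring
    rw [e]
    exact contDiff_mul_ballWeight_inv_pow (hu1.mul (hu1.mul (hx i)))
      ((tsupport_mul_subset_left).trans hs) 3

theorem energyField_eq_zero {u : E4 → ℝ} {x : E4} (hx : x ∉ tsupport u) (i : Fin 4) :
    energyField u i x = 0 := by
  have h1 : u x = 0 := image_eq_zero_of_notMem_tsupport hx
  have h2 : ∀ j, pderivE u j x = 0 := pderivE_eq_zero hx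
  simp [energyField, h1, h2]

theorem continuous_lapE {u : E4 → ℝ} (hu : ContDiff ℝ 2 u) : Continuous (lapE u) :=
  continuous_finsetSum _ fun i _ => (contDiff_pderivE (m := 0)
    (contDiff_pderivE (m := 1) hu (by norm_num) i) (by norm_num) i).continuous

theorem lapE_eq_zero {u : E4 → ℝ} {x : E4} (hx : x ∉ tsupport u) : lapE u x = 0 := by
  rw [lapE_eq_sum]
  exact Finset.sum_eq_zero fun i _ => pderivE_eq_zero (fun h => hx (tsupport_pderivE_subset u i h)) i

theorem continuous_adamsField {u : E4 → ℝ} (hu : ContDiff ℝ 2 u)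
    (hs : tsupport u ⊆ Metric.ball (0 : E4) 1) : Continuous (adamsField u) := by
  have hp : ∀ j, ContDiff ℝ 0 (pderivE u j) := fun j =>
    contDiff_pderivE (hu.of_le (m := 1) (by norm_num)) (by norm_num) j
  have h1 : Continuous fun x => ∑ i, pderivE u i x * x i * (ballWeight x)⁻¹ ^ 1 :=
    continuous_finsetSum _ fun i _ => (contDiff_mul_ballWeight_inv_pow ((hp i).mul (by fun_prop))
      (tsupport_mul_subset_left.trans ((tsupport_pderivE_subset u i).trans hs)) 1).continuous
  have h2 := (contDiff_mul_ballWeight_inv_pow (n := 0) (hu.of_le (by norm_num)) hs 2).continuous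
  have h3 := (((continuous_lapE hu).add (h1.const_mul 4)).add (h2.const_mul 9))
  convert h3 using 1
  funext x
  simp only [adamsField, Pi.add_apply, ← Finset.sum_mul, pow_one, mul_comm (x _)]
  ring

theorem adamsField_eq_zero {u : E4 → ℝ} {x : E4} (hx : x ∉ tsupport u) : adamsField u x = 0 := by
  simp [adamsField, lapE_eq_zero hx, pderivE_eq_zero hx, image_eq_zero_of_notMem_tsupport hx]

theorem lapE_sq_eq {u : E4 → ℝ} (hu : ContDiff ℝ 2 u)
    (hs : tsupport u ⊆ Metric.ball (0 : E4) 1) {x : E4} (hx : x ∈ Metric.ball (0 : E4) 1) :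
    lapE u x ^ 2 = adamsField u x ^ 2 + 9 * (u x ^ 2 * (ballWeight x)⁻¹ ^ 4)
      + 10 * (∑ i, (pderivE u i x + 3 * u x * x i * (ballWeight x)⁻¹) ^ 2) * (ballWeight x)⁻¹ ^ 2
      + 30 * u x ^ 2 * (ballWeight x)⁻¹ ^ 3 + ∑ i, pderivE (energyField u i) i x := by
  have hω : (1 - ∑ i, x i ^ 2) * (ballWeight x)⁻¹ = 1 := by
    rw [← ballWeight_eq]; exact mul_inv_cancel₀ (ballWeight_pos hx).ne'
  have hd : ∀ i, DifferentiableAt ℝ (energyField u i) x := fun i =>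
    (contDiff_energyField hu hs i).differentiable (by norm_num) x
  simp only [fun i => pderivE_energyField hu hx i (hd i)]
  exact sum_sq_identity (fun i j => pderivE_comm hu i j x) hω

/-- The square of `adamsField u` is controlled by the Rellich-type deficit. -/
theorem integral_sq_adamsField_le {u : E4 → ℝ} (hu : ContDiff ℝ 2 u) (hc : HasCompactSupport u)
    (hs : tsupport u ⊆ Metric.ball (0 : E4) 1) :
    (∫ x in Metric.ball (0 : E4) 1, adamsField u x ^ 2) +
      9 * ∫ x in Metric.ball (0 : E4) 1, u x ^ 2 / (1 - ‖x‖ ^ 2) ^ 4 ≤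
      ∫ x in Metric.ball (0 : E4) 1, |lapE u x| ^ 2 := by
  have hInt : ∀ {g : E4 → ℝ}, Continuous g → (∀ x ∉ tsupport u, g x = 0) → Integrable g :=
    fun hg h0 => hg.integrable_of_hasCompactSupport (HasCompactSupport.intro hc h0)
  have hu0 : ∀ x ∉ tsupport u, u x = 0 := fun x hx => image_eq_zero_of_notMem_tsupport hx
  have e : ∀ x : E4, u x ^ 2 / (1 - ‖x‖ ^ 2) ^ 4 = u x * u x * (ballWeight x)⁻¹ ^ 4 := fun x => by
    rw [ballWeight, div_eq_mul_inv, inv_pow]; ring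
  have i1 : Integrable fun x => adamsField u x ^ 2 :=
    hInt ((continuous_adamsField hu hs).pow 2) fun x hx => by simp [adamsField_eq_zero hx]
  have i2 : Integrable fun x : E4 => u x ^ 2 / (1 - ‖x‖ ^ 2) ^ 4 := by
    simp only [e]
    exact hInt (contDiff_mul_ballWeight_inv_pow (n := 0) ((hu.mul hu).of_le (by norm_num))
      (tsupport_mul_subset_left.trans hs) 4).continuous fun x hx => by simp [hu0 x hx]
  have i3 : Integrable fun x => |lapE u x| ^ 2 :=
    hInt ((continuous_lapE hu).abs.pow 2) fun x hx => by simp [lapE_eq_zero hx]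
  have hEc : ∀ i, HasCompactSupport (energyField u i) := fun i =>
    HasCompactSupport.intro hc fun x hx => energyField_eq_zero hx i
  have hE := contDiff_energyField hu hs
  have hsub : ∀ i, tsupport (energyField u i) ⊆ tsupport u := fun i =>
    closure_minimal (fun x hx => by_contra fun h => hx (energyField_eq_zero h i))
      (isClosed_tsupport u)
  have hEz : ∀ x ∉ tsupport u, ∀ i, pderivE (energyField u i) i x = 0 := fun x hx i =>
    pderivE_eq_zero (fun h => hx (hsub i h)) i
  have i4' : ∀ i, Integrable (pderivE (energyField u i) i) := fun i =>
    hInt (contDiff_pderivE (m := 0) (hE i) (by norm_num) i).continuous fun x hx => hEz x hx i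
  have i4 : Integrable fun x => ∑ i, pderivE (energyField u i) i x :=
    integrable_finsetSum _ fun i _ => i4' i
  have z4 : ∫ x in Metric.ball (0 : E4) 1, ∑ i, pderivE (energyField u i) i x = 0 := by
    rw [setIntegral_eq_integral_of_forall_compl_eq_zero fun x hx =>
      Finset.sum_eq_zero fun i _ => hEz x (fun h => hx (hs h)) i,
      integral_finsetSum _ fun i _ => i4' i]
    exact Finset.sum_eq_zero fun i _ => integral_pderivE_eq_zero (hE i) (hEc i) i
  calc _ = ∫ x in Metric.ball (0 : E4) 1, (adamsField u x ^ 2 +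
        9 * (u x ^ 2 / (1 - ‖x‖ ^ 2) ^ 4) + ∑ i, pderivE (energyField u i) i x) := by
        have i12 : Integrable fun x => adamsField u x ^ 2 + 9 * (u x ^ 2 / (1 - ‖x‖ ^ 2) ^ 4) :=
          i1.add (i2.const_mul 9)
        rw [integral_add i12.integrableOn i4.integrableOn,
          integral_add i1.integrableOn (i2.integrableOn.const_mul 9), z4, integral_const_mul,
          add_zero]
    _ ≤ _ := by
        refine setIntegral_mono_on ((i1.integrableOn.add (i2.integrableOn.const_mul 9)).add
          i4.integrableOn) i3.integrableOn measurableSet_ball fun x hx => ?_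
        have hw : 0 < (ballWeight x)⁻¹ := inv_pos.2 (ballWeight_pos hx)
        have h1 : 0 ≤ 10 * (∑ i, (pderivE u i x + 3 * u x * x i * (ballWeight x)⁻¹) ^ 2) *
          (ballWeight x)⁻¹ ^ 2 := by positivity
        have h2 : 0 ≤ 30 * u x ^ 2 * (ballWeight x)⁻¹ ^ 3 := by positivity
        rw [sq_abs, lapE_sq_eq hu hs hx, e]
        linarith

end

noncomputable section

/-- The point-pair invariant `|x - y|² / ((1 - |x|²)(1 - |y|²))` of the ball. -/
def ballPair (x y : E4) : ℝ := ‖x - y‖ ^ 2 * (ballWeight x)⁻¹ * (ballWeight y)⁻¹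

theorem ballPair_nonneg {x y : E4} (hx : x ∈ Metric.ball (0 : E4) 1)
    (hy : y ∈ Metric.ball (0 : E4) 1) : 0 ≤ ballPair x y := by
  have := ballWeight_pos hx
  have := ballWeight_pos hy
  unfold ballPair
  positivity

theorem ballPair_pos {x y : E4} (hx : x ∈ Metric.ball (0 : E4) 1)
    (hy : y ∈ Metric.ball (0 : E4) 1) (hxy : y ≠ x) : 0 < ballPair x y := by
  have := ballWeight_pos hx
  have := ballWeight_pos hy
  have : 0 < ‖x - y‖ := norm_pos_iff.2 (sub_ne_zero.2 hxy.symm)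
  unfold ballPair
  positivity

theorem ballPair_comm (x y : E4) : ballPair x y = ballPair y x := by
  rw [ballPair, ballPair, norm_sub_rev]; ring

/-- The partial derivatives of `ballPair x`. -/
def ballPairGrad (x : E4) (i : Fin 4) (y : E4) : ℝ :=
  (ballWeight x)⁻¹ * (2 * (y i - x i) * (ballWeight y)⁻¹ +
    2 * ((∑ j, (y j - x j) ^ 2) * y i * (ballWeight y)⁻¹ ^ 2))

theorem ballPair_eq (x y : E4) :
    ballPair x y = (ballWeight x)⁻¹ * ((∑ j, (y j - x j) ^ 2) * (ballWeight y)⁻¹) := by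
  rw [ballPair, norm_sub_rev, EuclideanSpace.real_norm_sq_eq]
  simp only [PiLp.sub_apply]
  ring

theorem hasDerivAt_ballWeight_inv {y : E4} (hy : y ∈ Metric.ball (0 : E4) 1) (i : Fin 4) :
    HasDerivAt (fun t : ℝ => (ballWeight (y + t • EuclideanSpace.single i (1 : ℝ)))⁻¹)
      (2 * y i * (ballWeight y)⁻¹ ^ 2) 0 := by
  have hw := (ballWeight_pos hy).ne'
  refine ((hasDerivAt_ballWeight y i).fun_inv (by simpa using hw)).congr_deriv ?_
  simp
  field_simp

theorem hasDerivAt_sum_sq_sub (x y : E4) (i : Fin 4) :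
    HasDerivAt (fun t : ℝ => ∑ j, ((y + t • EuclideanSpace.single i (1 : ℝ)) j - x j) ^ 2)
      (2 * (y i - x i)) 0 := by
  refine (HasDerivAt.fun_sum (u := Finset.univ) fun j _ =>
    ((hasDerivAt_coord y i j).sub_const (x j)).fun_pow 2).congr_deriv ?_
  simp

theorem hasDerivAt_ballPair (x : E4) {y : E4} (hy : y ∈ Metric.ball (0 : E4) 1) (i : Fin 4) :
    HasDerivAt (fun t : ℝ => ballPair x (y + t • EuclideanSpace.single i (1 : ℝ)))
      (ballPairGrad x i y) 0 := by
  simp only [ballPair_eq]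
  refine (((hasDerivAt_sum_sq_sub x y i).fun_mul (hasDerivAt_ballWeight_inv hy i)).const_mul
    _).congr_deriv ?_
  simp [ballPairGrad]
  left
  ring

theorem hasDerivAt_ballPairGrad (x : E4) {y : E4} (hy : y ∈ Metric.ball (0 : E4) 1) (i : Fin 4) :
    HasDerivAt (fun t : ℝ => ballPairGrad x i (y + t • EuclideanSpace.single i (1 : ℝ)))
      ((ballWeight x)⁻¹ * (2 * (ballWeight y)⁻¹ + 8 * (y i - x i) * y i * (ballWeight y)⁻¹ ^ 2
        + 2 * (∑ j, (y j - x j) ^ 2) * (ballWeight y)⁻¹ ^ 2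
        + 8 * (∑ j, (y j - x j) ^ 2) * y i ^ 2 * (ballWeight y)⁻¹ ^ 3)) 0 := by
  unfold ballPairGrad
  have h1 := hasDerivAt_ballWeight_inv hy i
  have h2 := hasDerivAt_coord y i i
  have h3 := hasDerivAt_sum_sq_sub x y i
  refine (((((h2.sub_const (x i)).const_mul 2).fun_mul h1).fun_add
    (((h3.fun_mul h2).fun_mul (h1.fun_pow 2)).const_mul 2)).const_mul _).congr_deriv ?_
  simp
  left
  ring

theorem contDiffOn_ballPair (x : E4) {n : WithTop ℕ∞} :
    ContDiffOn ℝ n (ballPair x) (Metric.ball 0 1) := by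
  have h := contDiffOn_ballWeight_inv_pow (n := n) 1
  simp only [pow_one] at h
  refine ContDiffOn.mul (ContDiff.contDiffOn ?_) h
  exact ((contDiff_const.sub contDiff_id).norm_sq ℝ).mul contDiff_const

theorem contDiffOn_ballPairGrad (x : E4) (i : Fin 4) {n : WithTop ℕ∞} :
    ContDiffOn ℝ n (ballPairGrad x i) (Metric.ball 0 1) := by
  have h1 := contDiffOn_ballWeight_inv_pow (n := n) 1
  have h2 := contDiffOn_ballWeight_inv_pow (n := n) 2
  simp only [pow_one] at h1
  refine contDiffOn_const.mul (ContDiffOn.add (ContDiffOn.mul (ContDiff.contDiffOn ?_) h1)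
    (contDiffOn_const.mul (ContDiffOn.mul (ContDiff.contDiffOn ?_) h2)))
  · fun_prop
  · fun_prop

/-- The vector field in Green's identity for `u` and `Ψ ∘ ballPair x`. -/
def greenField (Ψ Ψ₁ : ℝ → ℝ) (u : E4 → ℝ) (x : E4) (i : Fin 4) (y : E4) : ℝ :=
  pderivE u i y * (Ψ (ballPair x y) * (ballWeight y)⁻¹ ^ 2) -
    u y * (Ψ₁ (ballPair x y) * ballPairGrad x i y * (ballWeight y)⁻¹ ^ 2)

theorem sum_greenField_identity {p x y H : Fin 4 → ℝ} {u ω α q Ψ Ψ₁ Ψ₂ : ℝ}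
    (hω : (1 - ∑ i, y i ^ 2) * ω = 1) (hα : (1 - ∑ i, x i ^ 2) * α = 1)
    (hq : q = α * ((∑ j, (y j - x j) ^ 2) * ω)) {Q : Fin 4 → ℝ}
    (hQ : ∀ i, Q i = α * (2 * (y i - x i) * ω + 2 * ((∑ j, (y j - x j) ^ 2) * y i * ω ^ 2))) :
    ∑ i, (H i * (Ψ * ω ^ 2) + p i * (Ψ₁ * Q i * ω ^ 2 + Ψ * (4 * y i * ω ^ 3)) -
      (p i * (Ψ₁ * Q i * ω ^ 2) + u * (Ψ₂ * Q i ^ 2 * ω ^ 2 + Ψ₁ * (α * (2 * ω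
        + 8 * (y i - x i) * y i * ω ^ 2 + 2 * (∑ j, (y j - x j) ^ 2) * ω ^ 2
        + 8 * (∑ j, (y j - x j) ^ 2) * y i ^ 2 * ω ^ 3)) * ω ^ 2
        + Ψ₁ * Q i * (4 * y i * ω ^ 3)))) =
    (∑ i, H i + 4 * (∑ i, y i * p i) * ω) * ω ^ 2 * Ψ -
      u * ω ^ 4 * (4 * (q * (q + 1) * Ψ₂ + (2 + 4 * q) * Ψ₁)) := by
  have h1 : ∑ i, Q i ^ 2 = 4 * ω ^ 2 * (q * (q + 1)) := by
    simp only [hQ, hq]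
    simp only [Fin.sum_univ_four] at hω hα ⊢
    set N := (y 0 - x 0) ^ 2 + (y 1 - x 1) ^ 2 + (y 2 - x 2) ^ 2 + (y 3 - x 3) ^ 2 with hN
    linear_combination (-4 * α ^ 2 * N * ω ^ 2 * (1 + ω * N)) * hω + 4 * α * N * ω ^ 3 * hα +
      (-4 * α ^ 2 * ω ^ 2 - 4 * α ^ 2 * N * ω ^ 3) * hN
  have h2 : ∑ i, (α * (2 * ω + 8 * (y i - x i) * y i * ω ^ 2 + 2 * (∑ j, (y j - x j) ^ 2) * ω ^ 2
        + 8 * (∑ j, (y j - x j) ^ 2) * y i ^ 2 * ω ^ 3) * ω ^ 2 + Q i * (4 * y i * ω ^ 3)) =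
      4 * ω ^ 4 * (2 + 4 * q) := by
    simp only [hQ, hq]
    simp only [Fin.sum_univ_four] at hω hα ⊢
    linear_combination (-4 * α * ω ^ 3 * (2 + 4 * ω * ((y 0 - x 0) ^ 2 + (y 1 - x 1) ^ 2 +
      (y 2 - x 2) ^ 2 + (y 3 - x 3) ^ 2))) * hω + 8 * ω ^ 4 * hα
  calc _ = ∑ i, (H i * (Ψ * ω ^ 2) + (y i * p i) * (4 * ω ^ 3 * Ψ) - Q i ^ 2 * (u * Ψ₂ * ω ^ 2) -
        (α * (2 * ω + 8 * (y i - x i) * y i * ω ^ 2 + 2 * (∑ j, (y j - x j) ^ 2) * ω ^ 2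
        + 8 * (∑ j, (y j - x j) ^ 2) * y i ^ 2 * ω ^ 3) * ω ^ 2 + Q i * (4 * y i * ω ^ 3)) *
        (u * Ψ₁)) := Finset.sum_congr rfl fun i _ => by ring
    _ = _ := by
      rw [Finset.sum_sub_distrib, Finset.sum_sub_distrib, Finset.sum_add_distrib,
        ← Finset.sum_mul, ← Finset.sum_mul, ← Finset.sum_mul, ← Finset.sum_mul, h1, h2]
      ring


theorem contDiffOn_comp_ballPair {Ψ : ℝ → ℝ} {n : WithTop ℕ∞} (hΨ : ∀ q, 0 ≤ q → ContDiffAt ℝ n Ψ q)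
    {x : E4} (hx : x ∈ Metric.ball (0 : E4) 1) :
    ContDiffOn ℝ n (fun y => Ψ (ballPair x y)) (Metric.ball 0 1) := fun y hy =>
  (hΨ _ (ballPair_nonneg hx hy)).comp_contDiffWithinAt y (contDiffOn_ballPair x y hy)

section Green

variable {Ψ Ψ₁ Ψ₂ : ℝ → ℝ} {u : E4 → ℝ} {x : E4}

theorem contDiff_greenField (hu : ContDiff ℝ 2 u) (hs : tsupport u ⊆ Metric.ball (0 : E4) 1)
    (c : ∀ q, 0 ≤ q → ContDiffAt ℝ 1 Ψ q) (c₁ : ∀ q, 0 ≤ q → ContDiffAt ℝ 1 Ψ₁ q)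
    (hx : x ∈ Metric.ball (0 : E4) 1) (i : Fin 4) : ContDiff ℝ 1 (greenField Ψ Ψ₁ u x i) := by
  refine ContDiff.sub ?_ ?_
  · exact contDiff_mul_of_tsupport_subset Metric.isOpen_ball (contDiff_pderivE hu (by norm_num) i)
      ((tsupport_pderivE_subset u i).trans hs)
      ((contDiffOn_comp_ballPair c hx).mul (contDiffOn_ballWeight_inv_pow 2))
  · exact contDiff_mul_of_tsupport_subset Metric.isOpen_ball (hu.of_le (by norm_num)) hs
      (((contDiffOn_comp_ballPair c₁ hx).mul (contDiffOn_ballPairGrad x i)).mul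
        (contDiffOn_ballWeight_inv_pow 2))

theorem greenField_eq_zero {y : E4} (hy : y ∉ tsupport u) (i : Fin 4) :
    greenField Ψ Ψ₁ u x i y = 0 := by
  simp [greenField, pderivE_eq_zero hy, image_eq_zero_of_notMem_tsupport hy]

theorem sum_pderivE_greenField (hu : ContDiff ℝ 2 u) (hs : tsupport u ⊆ Metric.ball (0 : E4) 1)
    (c : ∀ q, 0 ≤ q → ContDiffAt ℝ 1 Ψ q) (c₁ : ∀ q, 0 ≤ q → ContDiffAt ℝ 1 Ψ₁ q)
    (h : ∀ q, 0 ≤ q → HasDerivAt Ψ (Ψ₁ q) q) (h₁ : ∀ q, 0 ≤ q → HasDerivAt Ψ₁ (Ψ₂ q) q)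
    (hx : x ∈ Metric.ball (0 : E4) 1) {y : E4} (hy : y ∈ Metric.ball (0 : E4) 1) :
    ∑ i, pderivE (greenField Ψ Ψ₁ u x i) i y =
      adamsField u y * (ballWeight y)⁻¹ ^ 2 * Ψ (ballPair x y) -
      u y * (ballWeight y)⁻¹ ^ 4 * (4 * (ballPair x y * (ballPair x y + 1) * Ψ₂ (ballPair x y) +
        (2 + 4 * ballPair x y) * Ψ₁ (ballPair x y)) + 9 * Ψ (ballPair x y)) := by
  have hω : (1 - ∑ i, y i ^ 2) * (ballWeight y)⁻¹ = 1 := by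
    rw [← ballWeight_eq]; exact mul_inv_cancel₀ (ballWeight_pos hy).ne'
  have hα : (1 - ∑ i, x i ^ 2) * (ballWeight x)⁻¹ = 1 := by
    rw [← ballWeight_eq]; exact mul_inv_cancel₀ (ballWeight_pos hx).ne'
  have hq0 := ballPair_nonneg hx hy
  have hp : ∀ j, DifferentiableAt ℝ (pderivE u j) y := fun j =>
    (contDiff_pderivE (m := 1) hu (by norm_num) j).differentiable (by norm_num) y
  have key := sum_greenField_identity (p := fun i => pderivE u i y) (x := x) (y := y)
    (H := fun i => pderivE (pderivE u i) i y) (u := u y) (Ψ := Ψ (ballPair x y))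
    (Ψ₁ := Ψ₁ (ballPair x y)) (Ψ₂ := Ψ₂ (ballPair x y)) hω hα (ballPair_eq x y)
    (Q := fun i => ballPairGrad x i y) (fun i => rfl)
  rw [← lapE_eq_sum] at key
  trans (lapE u y + 4 * (∑ i, y i * pderivE u i y) * (ballWeight y)⁻¹) * (ballWeight y)⁻¹ ^ 2 *
    Ψ (ballPair x y) - u y * (ballWeight y)⁻¹ ^ 4 * (4 * (ballPair x y * (ballPair x y + 1) *
      Ψ₂ (ballPair x y) + (2 + 4 * ballPair x y) * Ψ₁ (ballPair x y)))
  · rw [← key]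
    refine Finset.sum_congr rfl fun i _ => ?_
    have d := (contDiff_greenField hu hs c c₁ hx i).differentiable (by norm_num) y
    refine pderivE_eq_of_hasDerivAt d ?_
    have a0 := hasDerivAt_pderivE (hu.differentiable (by norm_num) y) i
    have a1 := hasDerivAt_pderivE (hp i) i
    have a2 := hasDerivAt_ballWeight_inv hy i
    have a3 := hasDerivAt_ballPair x hy i
    have a4 := hasDerivAt_ballPairGrad x hy i
    have a5 : HasDerivAt (fun t : ℝ => Ψ (ballPair x (y + t • EuclideanSpace.single i (1 : ℝ))))
        (Ψ₁ (ballPair x y) * ballPairGrad x i y) 0 :=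
      HasDerivAt.comp (0 : ℝ) (by simpa using h _ hq0) a3
    have a6 : HasDerivAt (fun t : ℝ => Ψ₁ (ballPair x (y + t • EuclideanSpace.single i (1 : ℝ))))
        (Ψ₂ (ballPair x y) * ballPairGrad x i y) 0 :=
      HasDerivAt.comp (0 : ℝ) (by simpa using h₁ _ hq0) a3
    refine ((a1.fun_mul (a5.fun_mul (a2.fun_pow 2))).fun_sub
      (a0.fun_mul ((a6.fun_mul a4).fun_mul (a2.fun_pow 2)))).congr_deriv ?_
    simp only [zero_smul, add_zero]
    norm_num
    ring
  · rw [adamsField]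
    ring

/-- Green's identity against a function of the point-pair invariant. -/
theorem integral_adamsField_mul_comp_ballPair (hu : ContDiff ℝ 2 u) (hc : HasCompactSupport u)
    (hs : tsupport u ⊆ Metric.ball (0 : E4) 1)
    (c : ∀ q, 0 ≤ q → ContDiffAt ℝ 1 Ψ q) (c₁ : ∀ q, 0 ≤ q → ContDiffAt ℝ 1 Ψ₁ q)
    (h : ∀ q, 0 ≤ q → HasDerivAt Ψ (Ψ₁ q) q) (h₁ : ∀ q, 0 ≤ q → HasDerivAt Ψ₁ (Ψ₂ q) q)
    (hx : x ∈ Metric.ball (0 : E4) 1) :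
    ∫ y in Metric.ball (0 : E4) 1, adamsField u y * (ballWeight y)⁻¹ ^ 2 * Ψ (ballPair x y) =
    ∫ y in Metric.ball (0 : E4) 1, u y * (ballWeight y)⁻¹ ^ 4 *
      (4 * (ballPair x y * (ballPair x y + 1) * Ψ₂ (ballPair x y) +
        (2 + 4 * ballPair x y) * Ψ₁ (ballPair x y)) + 9 * Ψ (ballPair x y)) := by
  have hInt : ∀ {g : E4 → ℝ}, Continuous g → (∀ x ∉ tsupport u, g x = 0) → Integrable g :=
    fun hg h0 => hg.integrable_of_hasCompactSupport (HasCompactSupport.intro hc h0)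
  have hX := fun i => contDiff_greenField hu hs c c₁ hx i
  have hXc : ∀ i, HasCompactSupport (greenField Ψ Ψ₁ u x i) := fun i =>
    HasCompactSupport.intro hc fun y hy => greenField_eq_zero hy i
  have hsub : ∀ i, tsupport (greenField Ψ Ψ₁ u x i) ⊆ tsupport u := fun i =>
    closure_minimal (fun y hy => by_contra fun h => hy (greenField_eq_zero h i))
      (isClosed_tsupport u)
  have hXz : ∀ y ∉ tsupport u, ∀ i, pderivE (greenField Ψ Ψ₁ u x i) i y = 0 := fun y hy i =>
    pderivE_eq_zero (fun h => hy (hsub i h)) i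
  have i4' : ∀ i, Integrable (pderivE (greenField Ψ Ψ₁ u x i) i) := fun i =>
    hInt (contDiff_pderivE (m := 0) (hX i) (by norm_num) i).continuous fun y hy => hXz y hy i
  have i4 : Integrable fun y => ∑ i, pderivE (greenField Ψ Ψ₁ u x i) i y :=
    integrable_finsetSum _ fun i _ => i4' i
  have z4 : ∫ y in Metric.ball (0 : E4) 1, ∑ i, pderivE (greenField Ψ Ψ₁ u x i) i y = 0 := by
    rw [setIntegral_eq_integral_of_forall_compl_eq_zero fun y hy =>
      Finset.sum_eq_zero fun i _ => hXz y (fun h => hy (hs h)) i,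
      integral_finsetSum _ fun i _ => i4' i]
    exact Finset.sum_eq_zero fun i _ => integral_pderivE_eq_zero (hX i) (hXc i) i
  have hfs : tsupport (adamsField u) ⊆ tsupport u :=
    closure_minimal (fun y hy => by_contra fun h => hy (adamsField_eq_zero h)) (isClosed_tsupport u)
  have i1 : Integrable fun y => adamsField u y * ((ballWeight y)⁻¹ ^ 2 * Ψ (ballPair x y)) := by
    refine hInt (contDiff_zero.1 (contDiff_mul_of_tsupport_subset (n := 0) Metric.isOpen_ball
      (contDiff_zero.2 (continuous_adamsField hu hs)) (hfs.trans hs)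
      ((contDiffOn_ballWeight_inv_pow 2).mul
        (contDiffOn_comp_ballPair (fun q hq => (c q hq).of_le (by norm_num)) hx)))) fun y hy => ?_
    simp [adamsField_eq_zero hy]
  simp only [← mul_assoc] at i1
  rw [← sub_zero (∫ y in Metric.ball (0 : E4) 1, adamsField u y * (ballWeight y)⁻¹ ^ 2 *
    Ψ (ballPair x y)), ← z4, ← integral_sub i1.integrableOn i4.integrableOn]
  refine setIntegral_congr_fun measurableSet_ball fun y hy => ?_
  simp only [sum_pderivE_greenField hu hs c c₁ h h₁ hx hy]
  ring

end Green

end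

noncomputable section

/-- The regularised logarithmic kernel on the ball; `greenLog 0` is the unregularised one. -/
def greenLog (ε q : ℝ) : ℝ := log (q + 1) - log (q + ε) - (q + 1)⁻¹

/-- The regularised parametrix on the ball; `greenKer 0` is the unregularised one. -/
def greenKer (ε q : ℝ) : ℝ := (q + ε)⁻¹ - (q + 1)⁻¹ + 4⁻¹ * greenLog ε q

/-- The approximate identity produced by `greenKer ε`. -/
def greenBump (ε q : ℝ) : ℝ :=
  2 * ε * (1 - ε) * (q + ε)⁻¹ ^ 3 - 2⁻¹ * ε * (q + ε)⁻¹ + 4⁻¹ * (ε * (1 - ε)) * (q + ε)⁻¹ ^ 2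

theorem contDiffAt_inv_add {ε q : ℝ} (h : q + ε ≠ 0) {n : WithTop ℕ∞} :
    ContDiffAt ℝ n (fun q => (q + ε)⁻¹) q :=
  (contDiffAt_id.add contDiffAt_const).inv h

theorem hasDerivAt_inv_add {ε q : ℝ} (h : q + ε ≠ 0) :
    HasDerivAt (fun q => (q + ε)⁻¹) (-(q + ε)⁻¹ ^ 2) q := by
  refine (((hasDerivAt_id q).add_const ε).fun_inv h).congr_deriv ?_
  simp
  field_simp

theorem contDiffAt_greenKer {ε q : ℝ} (hε : 0 < ε) (hq : 0 ≤ q) {n : WithTop ℕ∞} :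
    ContDiffAt ℝ n (greenKer ε) q := by
  have h1 : q + ε ≠ 0 := by positivity
  have h2 : q + 1 ≠ 0 := by positivity
  exact ((contDiffAt_inv_add h1).sub (contDiffAt_inv_add h2)).add (contDiffAt_const.mul
    ((((contDiffAt_id.add contDiffAt_const).log h2).sub
      ((contDiffAt_id.add contDiffAt_const).log h1)).sub (contDiffAt_inv_add h2)))

/-- The derivative of `greenKer ε`. -/
def greenKerDeriv (ε q : ℝ) : ℝ :=
  (q + 1)⁻¹ ^ 2 - (q + ε)⁻¹ ^ 2 + 4⁻¹ * ((q + 1)⁻¹ - (q + ε)⁻¹ + (q + 1)⁻¹ ^ 2)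

theorem contDiffAt_greenKerDeriv {ε q : ℝ} (hε : 0 < ε) (hq : 0 ≤ q) {n : WithTop ℕ∞} :
    ContDiffAt ℝ n (greenKerDeriv ε) q := by
  have h1 : q + ε ≠ 0 := by positivity
  have h2 : q + 1 ≠ 0 := by positivity
  exact (((contDiffAt_inv_add h2).pow 2).sub ((contDiffAt_inv_add h1).pow 2)).add
    (contDiffAt_const.mul (((contDiffAt_inv_add h2).sub (contDiffAt_inv_add h1)).add
      ((contDiffAt_inv_add h2).pow 2)))

theorem hasDerivAt_greenKer {ε q : ℝ} (hε : 0 < ε) (hq : 0 ≤ q) :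
    HasDerivAt (greenKer ε) (greenKerDeriv ε q) q := by
  have h1 : q + ε ≠ 0 := by positivity
  have h2 : q + 1 ≠ 0 := by positivity
  refine (((hasDerivAt_inv_add h1).fun_sub (hasDerivAt_inv_add h2)).fun_add
    ((((((hasDerivAt_id q).add_const 1).log h2).fun_sub
      (((hasDerivAt_id q).add_const ε).log h1)).fun_sub
        (hasDerivAt_inv_add h2)).const_mul 4⁻¹)).congr_deriv ?_
  simp only [greenKerDeriv, id, one_div]
  ring

theorem hasDerivAt_greenKerDeriv {ε q : ℝ} (hε : 0 < ε) (hq : 0 ≤ q) :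
    HasDerivAt (greenKerDeriv ε) (2 * (q + ε)⁻¹ ^ 3 - 2 * (q + 1)⁻¹ ^ 3 +
      4⁻¹ * ((q + ε)⁻¹ ^ 2 - (q + 1)⁻¹ ^ 2 - 2 * (q + 1)⁻¹ ^ 3)) q := by
  have h1 := hasDerivAt_inv_add (ε := ε) (q := q) (by positivity)
  have h2 := hasDerivAt_inv_add (ε := 1) (q := q) (by positivity)
  refine (((h2.fun_pow 2).fun_sub (h1.fun_pow 2)).fun_add
    (((h2.fun_sub h1).fun_add (h2.fun_pow 2)).const_mul 4⁻¹)).congr_deriv ?_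
  ring

theorem greenKer_ode {ε q : ℝ} (hε : 0 < ε) (hq : 0 ≤ q) :
    4 * (q * (q + 1) * (2 * (q + ε)⁻¹ ^ 3 - 2 * (q + 1)⁻¹ ^ 3 +
      4⁻¹ * ((q + ε)⁻¹ ^ 2 - (q + 1)⁻¹ ^ 2 - 2 * (q + 1)⁻¹ ^ 3)) +
      (2 + 4 * q) * greenKerDeriv ε q) + 9 * greenKer ε q =
    -4 * greenBump ε q + 9 / 4 * greenLog ε q := by
  have h1 : q + ε ≠ 0 := by positivity
  have h2 : q + 1 ≠ 0 := by positivity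
  simp only [greenKer, greenKerDeriv, greenBump]
  field_simp
  ring

theorem integral_mul_greenBump {u : E4 → ℝ} (hu : ContDiff ℝ 2 u) (hc : HasCompactSupport u)
    (hs : tsupport u ⊆ Metric.ball (0 : E4) 1) {x : E4} (hx : x ∈ Metric.ball (0 : E4) 1)
    {ε : ℝ} (hε : 0 < ε) :
    ∫ y in Metric.ball (0 : E4) 1, adamsField u y * (ballWeight y)⁻¹ ^ 2 *
        greenKer ε (ballPair x y) =
      ∫ y in Metric.ball (0 : E4) 1, u y * (ballWeight y)⁻¹ ^ 4 *
        (-4 * greenBump ε (ballPair x y) + 9 / 4 * greenLog ε (ballPair x y)) := by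
  rw [integral_adamsField_mul_comp_ballPair hu hc hs
    (fun q hq => contDiffAt_greenKer hε hq) (fun q hq => contDiffAt_greenKerDeriv hε hq)
    (fun q hq => hasDerivAt_greenKer hε hq) (fun q hq => hasDerivAt_greenKerDeriv hε hq) hx]
  refine setIntegral_congr_fun measurableSet_ball fun y hy => ?_
  rw [greenKer_ode hε (ballPair_nonneg hx hy)]

theorem greenLog_nonneg {q : ℝ} (hq : 0 < q) : 0 ≤ greenLog 0 q := by
  have h := one_sub_inv_le_log_of_pos (x := (q + 1) / q) (by positivity)
  rw [log_div (by positivity) hq.ne'] at h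
  have : 1 - ((q + 1) / q)⁻¹ = (q + 1)⁻¹ := by field_simp; ring
  rw [greenLog, add_zero]
  linarith

theorem greenKer_nonneg {q : ℝ} (hq : 0 < q) : 0 ≤ greenKer 0 q := by
  have := greenLog_nonneg hq
  have : (q + 1)⁻¹ ≤ q⁻¹ := inv_anti₀ hq (by linarith)
  rw [greenKer, add_zero]
  linarith

theorem abs_greenLog_le {ε q : ℝ} (hε : 0 < ε) (hq : 0 < q) :
    |greenLog ε q| ≤ greenLog 0 q + ε := by
  have h0 := greenLog_nonneg hq
  have h := one_sub_inv_le_log_of_pos (x := (q + 1) / (q + ε)) (by positivity)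
  rw [log_div (by positivity) (by positivity)] at h
  have h1 : 1 - ((q + 1) / (q + ε))⁻¹ - (q + 1)⁻¹ = - (ε * (q + 1)⁻¹) := by
    field_simp; ring
  have h2 : ε * (q + 1)⁻¹ ≤ ε := mul_le_of_le_one_right hε.le (inv_le_one_of_one_le₀ (by linarith))
  have h3 : log q ≤ log (q + ε) := log_le_log hq (by linarith)
  simp only [greenLog, add_zero] at *
  rw [abs_le]
  constructor <;> linarith

theorem abs_greenKer_le {ε q : ℝ} (hε : 0 < ε) (hε1 : ε ≤ 1) (hq : 0 < q) :
    |greenKer ε q| ≤ greenKer 0 q + ε := by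
  have h := abs_le.1 (abs_greenLog_le hε hq)
  have h0 := greenLog_nonneg hq
  have h1 : (q + 1)⁻¹ ≤ (q + ε)⁻¹ := inv_anti₀ (by linarith) (by linarith)
  have h2 : (q + ε)⁻¹ ≤ q⁻¹ := inv_anti₀ hq (by linarith)
  have h3 : greenLog ε q ≤ greenLog 0 q := by
    have : log q ≤ log (q + ε) := log_le_log hq (by linarith)
    simp only [greenLog, add_zero]
    linarith
  simp only [greenKer, add_zero]
  rw [abs_le]
  constructor <;> linarith

end

noncomputable section

theorem volume_ball_E4 : volume (Metric.ball (0 : E4) 1) = ENNReal.ofReal (π ^ 2 / 2) := by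
  rw [InnerProductSpace.volume_ball_of_dim_even (k := 2) (by simp)]
  simp [Nat.factorial]

theorem lintegral_fun_norm_E4 {f : ℝ → ENNReal} (hf : Measurable f) :
    ∫⁻ x : E4, f ‖x‖ = ENNReal.ofReal (2 * π ^ 2) *
      ∫⁻ r in Set.Ioi (0 : ℝ), ENNReal.ofReal (r ^ 3) * f r := by
  calc ∫⁻ x : E4, f ‖x‖
      = ∫⁻ x : ({(0 : E4)}ᶜ : Set E4), f ‖x.1‖ ∂((volume : Measure E4).comap Subtype.val) := by
        rw [lintegral_subtype_comap (measurableSet_singleton _).compl (fun x : E4 => f ‖x‖),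
          restrict_compl_singleton]
    _ = ∫⁻ z, f z.2 ∂((volume : Measure E4).toSphere.prod (.volumeIoiPow (Module.finrank ℝ E4 - 1))) := by
        have := (volume : Measure E4).measurePreserving_homeomorphUnitSphereProd.lintegral_comp
          (f := fun z => f z.2) (by fun_prop)
        simpa using this
    _ = _ := by
        rw [lintegral_prod _ (by fun_prop)]
        simp only [lintegral_const, Measure.toSphere_apply_univ, volume_ball_E4]
        rw [mul_comm]
        congr 1
        · simp only [finrank_euclideanSpace, Fintype.card_fin]
          rw [← ENNReal.ofReal_natCast, ← ENNReal.ofReal_mul (by positivity)]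
          congr 1; push_cast; ring
        · rw [Measure.volumeIoiPow, lintegral_withDensity_eq_lintegral_mul _ (by fun_prop) (by fun_prop)]
          simp only [finrank_euclideanSpace, Fintype.card_fin]
          exact lintegral_subtype_comap measurableSet_Ioi (fun r : ℝ => ENNReal.ofReal (r ^ 3) * f r)

theorem lintegral_ball_fun_norm_E4 {f : ℝ → ENNReal} (hf : Measurable f) :
    ∫⁻ x in Metric.ball (0 : E4) 1, f ‖x‖ = ENNReal.ofReal (2 * π ^ 2) *
      ∫⁻ r in Set.Ioo (0 : ℝ) 1, ENNReal.ofReal (r ^ 3) * f r := by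
  have h : (Metric.ball (0 : E4) 1).indicator (fun x => f ‖x‖) =
      fun x => (Set.Iio (1 : ℝ)).indicator f ‖x‖ := by
    ext x
    simp [Set.indicator]
  rw [← lintegral_indicator measurableSet_ball, h,
    lintegral_fun_norm_E4 (hf.indicator measurableSet_Iio), ← Set.Iio_inter_Ioi,
    ← Measure.restrict_restrict measurableSet_Iio, ← lintegral_indicator measurableSet_Iio]
  simp only [Set.indicator_apply, mul_ite, mul_zero]

end

noncomputable section

theorem lintegral_japaneseBracket_E4 :
    ∫⁻ z : E4, ENNReal.ofReal ((1 + ‖z‖ ^ 2)⁻¹ ^ 3) = ENNReal.ofReal (π ^ 2 / 2) := by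
  have hlim : Filter.Tendsto (fun r : ℝ => (1 + r ^ 2)⁻¹) Filter.atTop (nhds 0) :=
    (Filter.tendsto_atTop_add_const_left _ _
      (Filter.tendsto_pow_atTop two_ne_zero)).inv_tendsto_atTop
  have h := lintegral_Ioi_of_hasDerivAt_of_nonneg (a := 0) (l := 0)
    (g := fun r : ℝ => 4⁻¹ * (1 + r ^ 2)⁻¹ ^ 2 - 2⁻¹ * (1 + r ^ 2)⁻¹)
    (g' := fun r => r ^ 3 * (1 + r ^ 2)⁻¹ ^ 3) (fun r _ => ?_) (fun r hr => ?_) ?_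
  · rw [lintegral_fun_norm_E4 (f := fun r => ENNReal.ofReal ((1 + r ^ 2)⁻¹ ^ 3)) (by fun_prop)]
    have h2 : ∫⁻ r in Set.Ioi (0 : ℝ), ENNReal.ofReal (r ^ 3) *
        ENNReal.ofReal ((1 + r ^ 2)⁻¹ ^ 3) =
        ∫⁻ r in Set.Ioi (0 : ℝ), ENNReal.ofReal (r ^ 3 * (1 + r ^ 2)⁻¹ ^ 3) :=
      setLIntegral_congr_fun measurableSet_Ioi fun r (hr : 0 < r) =>
        (ENNReal.ofReal_mul (by positivity)).symm
    rw [h2, h, ← ENNReal.ofReal_mul (by positivity)]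
    congr 1
    norm_num
    ring
  · have h1 : HasDerivAt (fun r : ℝ => (1 + r ^ 2)⁻¹) (-(2 * r) * (1 + r ^ 2)⁻¹ ^ 2) r := by
      refine ((((hasDerivAt_id r).fun_pow 2).const_add 1).fun_inv (by simp; positivity)).congr_deriv ?_
      simp
      field_simp
    refine (((h1.fun_pow 2).const_mul 4⁻¹).fun_sub (h1.const_mul 2⁻¹)).congr_deriv ?_
    have h2 : (1 + r ^ 2) * (1 + r ^ 2)⁻¹ = 1 := mul_inv_cancel₀ (by positivity)
    simp only [Nat.add_one_sub_one, pow_one, Nat.cast_ofNat]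
    linear_combination -r * (1 + r ^ 2)⁻¹ ^ 2 * h2
  · have : 0 < r := hr
    positivity
  · simpa using ((hlim.pow 2).const_mul (4 : ℝ)⁻¹).sub (hlim.const_mul (2 : ℝ)⁻¹)

theorem integrable_japaneseBracket_E4 :
    Integrable (fun z : E4 => (1 + ‖z‖ ^ 2)⁻¹ ^ 3) := by
  refine ⟨Measurable.aestronglyMeasurable (by fun_prop), ?_⟩
  rw [hasFiniteIntegral_iff_ofReal (Filter.Eventually.of_forall fun z => by positivity),
    lintegral_japaneseBracket_E4]
  exact ENNReal.ofReal_lt_top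

theorem integral_japaneseBracket_E4 : ∫ z : E4, (1 + ‖z‖ ^ 2)⁻¹ ^ 3 = π ^ 2 / 2 := by
  rw [integral_eq_lintegral_of_nonneg_ae (Filter.Eventually.of_forall fun z => by positivity)
    integrable_japaneseBracket_E4.1, lintegral_japaneseBracket_E4,
    ENNReal.toReal_ofReal (by positivity)]

/-- The rescaled profile of `greenBump`. -/
def bumpProfile (ε ρ : ℝ) : ℝ :=
  2 * (1 - ε) * (1 + ρ)⁻¹ ^ 3 - 2⁻¹ * ε ^ 2 * (1 + ρ)⁻¹ + 4⁻¹ * (ε * (1 - ε)) * (1 + ρ)⁻¹ ^ 2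

theorem greenBump_mul {ε ρ : ℝ} (hε : ε ≠ 0) :
    ε ^ 2 * greenBump ε (ε * ρ) = bumpProfile ε ρ := by
  have : ε * ρ + ε = ε * (1 + ρ) := by ring
  rw [greenBump, bumpProfile, this, mul_inv]
  field_simp

theorem abs_bumpProfile_le {ε ρ t : ℝ} (hε : 0 < ε) (hε1 : ε ≤ 1) (ht : 0 ≤ t) (hρ : t ≤ ρ)
    (hεt : ε * (1 + t) ≤ 5) : |bumpProfile ε ρ| ≤ 16 * (1 + t)⁻¹ ^ 3 := by
  have h1 : (1 + ρ)⁻¹ ≤ (1 + t)⁻¹ := inv_anti₀ (by linarith) (by linarith)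
  have h2 : 0 ≤ (1 + ρ)⁻¹ := inv_nonneg.2 (by linarith)
  have h3 : ε ≤ 5 * (1 + t)⁻¹ := by
    rw [← div_eq_mul_inv, le_div_iff₀ (by linarith)]; exact hεt
  set s := (1 + t)⁻¹
  set r := (1 + ρ)⁻¹
  have hr3 : r ^ 3 ≤ s ^ 3 := pow_le_pow_left₀ h2 h1 3
  have hr2 : r ^ 2 ≤ s ^ 2 := pow_le_pow_left₀ h2 h1 2
  have hs : 0 ≤ s := h2.trans h1
  have e1 : ε ^ 2 * r ≤ (5 * s) ^ 2 * s := by gcongr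
  have e2 : ε * (1 - ε) * r ^ 2 ≤ (5 * s * 1) * s ^ 2 := by gcongr; linarith
  have e3 : (1 - ε) * r ^ 3 ≤ 1 * s ^ 3 := by gcongr; linarith
  have p1 : 0 ≤ (1 - ε) * r ^ 3 := mul_nonneg (by linarith) (by positivity)
  have p2 : 0 ≤ ε * (1 - ε) * r ^ 2 :=
    mul_nonneg (mul_nonneg hε.le (by linarith)) (by positivity)
  have p3 : 0 ≤ ε ^ 2 * r := by positivity
  rw [bumpProfile, abs_le]
  change -(16 * s ^ 3) ≤ 2 * (1 - ε) * r ^ 3 - 2⁻¹ * ε ^ 2 * r + 4⁻¹ * (ε * (1 - ε)) * r ^ 2 ∧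
    2 * (1 - ε) * r ^ 3 - 2⁻¹ * ε ^ 2 * r + 4⁻¹ * (ε * (1 - ε)) * r ^ 2 ≤ 16 * s ^ 3
  constructor <;> nlinarith

theorem tendsto_integral_mul_greenBump {U : E4 → ℝ} (hU : Continuous U) (hc : HasCompactSupport U)
    (hs : tsupport U ⊆ Metric.ball (0 : E4) 1) {x : E4} (hx : x ∈ Metric.ball (0 : E4) 1) :
    Filter.Tendsto (fun δ : ℝ => ∫ y, U y * greenBump (δ ^ 2) (ballPair x y))
      (nhdsWithin 0 (Set.Ioi 0)) (nhds (π ^ 2 * (ballWeight x ^ 4 * U x))) := by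
  have ha := ballWeight_pos hx
  have ha1 : ballWeight x ≤ 1 := by unfold ballWeight; nlinarith [norm_nonneg x]
  obtain ⟨C, hC⟩ := hc.exists_bound_of_continuous hU
  have hC0 : 0 ≤ C := (norm_nonneg _).trans (hC 0)
  have key : ∀ δ : ℝ, 0 < δ → ∫ y, U y * greenBump (δ ^ 2) (ballPair x y) =
      ∫ z, U (x + δ • z) * bumpProfile (δ ^ 2)
        (‖z‖ ^ 2 * (ballWeight x)⁻¹ * (ballWeight (x + δ • z))⁻¹) := by
    intro δ hδ
    rw [← integral_add_left_eq_self _ x]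
    have h := Measure.integral_comp_smul (volume : Measure E4)
      (fun y => U (x + y) * greenBump (δ ^ 2) (ballPair x (x + y))) δ
    rw [abs_of_nonneg (by positivity), finrank_euclideanSpace, Fintype.card_fin, smul_eq_mul,
      eq_comm, inv_mul_eq_iff_eq_mul₀ (by positivity)] at h
    rw [h, ← integral_const_mul]
    congr 1 with z
    have : ballPair x (x + δ • z) =
        δ ^ 2 * (‖z‖ ^ 2 * (ballWeight x)⁻¹ * (ballWeight (x + δ • z))⁻¹) := by
      rw [ballPair]
      simp only [sub_add_cancel_left, norm_neg, norm_smul, norm_eq_abs, mul_pow, sq_abs]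
      ring
    rw [this, ← greenBump_mul (by positivity)]
    ring
  have hI : ∫ z : E4, U x * (2 * (1 + ‖z‖ ^ 2 * (ballWeight x)⁻¹ * (ballWeight x)⁻¹)⁻¹ ^ 3) =
      π ^ 2 * (ballWeight x ^ 4 * U x) := by
    have h := Measure.integral_comp_smul (volume : Measure E4)
      (fun z => (1 + ‖z‖ ^ 2)⁻¹ ^ 3) (ballWeight x)⁻¹
    rw [integral_japaneseBracket_E4, abs_of_nonneg (by positivity), finrank_euclideanSpace,
      Fintype.card_fin, smul_eq_mul] at h
    have h2 : ∀ z : E4, U x * (2 * (1 + ‖z‖ ^ 2 * (ballWeight x)⁻¹ * (ballWeight x)⁻¹)⁻¹ ^ 3) =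
        (2 * U x) * (1 + ‖(ballWeight x)⁻¹ • z‖ ^ 2)⁻¹ ^ 3 := fun z => by
      rw [norm_smul, norm_eq_abs, mul_pow, sq_abs]; ring_nf
    simp only [h2]
    rw [integral_const_mul, h, inv_pow, inv_inv]
    ring
  rw [← hI]
  refine Filter.Tendsto.congr' (f₁ := fun δ : ℝ => ∫ z, U (x + δ • z) * bumpProfile (δ ^ 2)
        (‖z‖ ^ 2 * (ballWeight x)⁻¹ * (ballWeight (x + δ • z))⁻¹)) ?_ ?_
  · filter_upwards [self_mem_nhdsWithin] with δ hδ using (key δ hδ).symm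
  refine tendsto_integral_filter_of_dominated_convergence
    (fun z => C * (16 * (1 + ‖z‖ ^ 2)⁻¹ ^ 3)) ?_ ?_ ?_ ?_
  · refine Filter.Eventually.of_forall fun δ => Measurable.aestronglyMeasurable ?_
    have := hU.measurable
    unfold bumpProfile ballWeight
    fun_prop
  · filter_upwards [Ioo_mem_nhdsGT (zero_lt_one' ℝ)] with δ hδ
    refine Filter.Eventually.of_forall fun z => ?_
    by_cases hz : x + δ • z ∈ tsupport U
    · have hz' := hs hz
      have hw := ballWeight_pos hz'
      have hw1 : ballWeight (x + δ • z) ≤ 1 := by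
        unfold ballWeight; nlinarith [norm_nonneg (x + δ • z)]
      rw [norm_mul]
      refine mul_le_mul (hC _) ?_ (norm_nonneg _) hC0
      refine abs_bumpProfile_le (by have := hδ.1; positivity) (by nlinarith [hδ.1, hδ.2])
        (by positivity) ?_ ?_
      · rw [mul_assoc]
        exact le_mul_of_one_le_right (by positivity)
          (one_le_mul_of_one_le_of_one_le (one_le_inv₀ ha |>.2 ha1) (one_le_inv₀ hw |>.2 hw1))
      · have h1 : ‖δ • z‖ ≤ 2 := by
          have : δ • z = (x + δ • z) - x := by abel
          rw [this]
          refine (norm_sub_le _ _).trans ?_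
          have := mem_ball_zero_iff.1 hz'
          have := mem_ball_zero_iff.1 hx
          linarith
        have h2 : ‖δ • z‖ ^ 2 = δ ^ 2 * ‖z‖ ^ 2 := by
          rw [norm_smul, norm_eq_abs, mul_pow, sq_abs]
        nlinarith [norm_nonneg (δ • z), hδ.1, hδ.2]
    · rw [image_eq_zero_of_notMem_tsupport hz]
      simp only [zero_mul, norm_zero]
      positivity
  · exact (integrable_japaneseBracket_E4.const_mul 16).const_mul C
  · refine Filter.Eventually.of_forall fun z => ?_
    have h1 : Filter.Tendsto (fun δ : ℝ => x + δ • z) (nhdsWithin 0 (Set.Ioi 0)) (nhds x) := by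
      have : Continuous fun δ : ℝ => x + δ • z := by fun_prop
      simpa using (this.tendsto 0).mono_left nhdsWithin_le_nhds
    have h2 : Filter.Tendsto (fun δ : ℝ => δ ^ 2) (nhdsWithin 0 (Set.Ioi 0)) (nhds 0) := by
      have : Continuous fun δ : ℝ => δ ^ 2 := by fun_prop
      simpa using (this.tendsto 0).mono_left nhdsWithin_le_nhds
    have h3 := ((contDiff_ballWeight (n := 0)).continuous.tendsto x).comp h1
    have h4 := ((h3.inv₀ ha.ne').const_mul (‖z‖ ^ 2 * (ballWeight x)⁻¹)).const_add 1 |>.inv₀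
      (by positivity)
    refine ((hU.tendsto x).comp h1).mul ?_
    have h5 := (((((h2.const_sub 1).const_mul 2).mul (h4.pow 3)).sub
      (((h2.pow 2).const_mul 2⁻¹).mul h4)).add
        (((h2.mul (h2.const_sub 1)).const_mul 4⁻¹).mul (h4.pow 2)))
    simpa [bumpProfile] using h5

end

noncomputable section

theorem integrable_mul_comp_ballPair {φ : E4 → ℝ} (hφ : Continuous φ) (hc : HasCompactSupport φ)
    (hs : tsupport φ ⊆ Metric.ball (0 : E4) 1) {Ψ : ℝ → ℝ} (hΨ : ∀ q, 0 ≤ q → ContDiffAt ℝ 0 Ψ q)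
    {x : E4} (hx : x ∈ Metric.ball (0 : E4) 1) :
    Integrable (fun y => φ y * Ψ (ballPair x y)) :=
  (contDiff_mul_of_tsupport_subset Metric.isOpen_ball (contDiff_zero.2 hφ) hs
    (contDiffOn_comp_ballPair hΨ hx)).continuous.integrable_of_hasCompactSupport hc.mul_right

theorem enorm_integral_mul_comp_ballPair_le {φ : E4 → ℝ} (hφ : Measurable φ)
    {Ψ Ψ₀ : ℝ → ℝ} {ε : ℝ} (h : ∀ q, 0 < q → |Ψ q| ≤ Ψ₀ q + ε)
    {x : E4} (hx : x ∈ Metric.ball (0 : E4) 1) :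
    ‖∫ y in Metric.ball (0 : E4) 1, φ y * Ψ (ballPair x y)‖ₑ ≤
      (∫⁻ y in Metric.ball (0 : E4) 1, ‖φ y‖ₑ * ENNReal.ofReal (Ψ₀ (ballPair x y))) +
        (∫⁻ y in Metric.ball (0 : E4) 1, ‖φ y‖ₑ) * ENNReal.ofReal ε := by
  refine (enorm_integral_le_lintegral_enorm _).trans ?_
  rw [← lintegral_mul_const _ hφ.enorm, ← lintegral_add_right _ (hφ.enorm.mul_const _)]
  refine lintegral_mono_ae ?_
  have hne : ∀ᵐ y ∂(volume.restrict (Metric.ball (0 : E4) 1)), y ≠ x :=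
    ae_restrict_of_ae (by simp [ae_iff])
  filter_upwards [ae_restrict_mem measurableSet_ball, hne] with y hy hxy
  rw [enorm_mul, ← mul_add]
  gcongr
  rw [enorm_eq_ofReal_abs]
  exact (ENNReal.ofReal_le_ofReal (h _ (ballPair_pos hx hy hxy))).trans ENNReal.ofReal_add_le

theorem contDiffAt_greenLog {ε q : ℝ} (hε : 0 < ε) (hq : 0 ≤ q) {n : WithTop ℕ∞} :
    ContDiffAt ℝ n (greenLog ε) q := by
  have h1 : q + ε ≠ 0 := by positivity
  have h2 : q + 1 ≠ 0 := by positivity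
  exact (((contDiffAt_id.add contDiffAt_const).log h2).sub
      ((contDiffAt_id.add contDiffAt_const).log h1)).sub (contDiffAt_inv_add h2)

theorem contDiffAt_greenBump {ε q : ℝ} (hε : 0 < ε) (hq : 0 ≤ q) {n : WithTop ℕ∞} :
    ContDiffAt ℝ n (greenBump ε) q := by
  have h1 : q + ε ≠ 0 := by positivity
  exact ((contDiffAt_const.mul ((contDiffAt_inv_add h1).pow 3)).sub
    (contDiffAt_const.mul (contDiffAt_inv_add h1))).add
      (contDiffAt_const.mul ((contDiffAt_inv_add h1).pow 2))

theorem ofReal_abs_le_lintegral_green {u : E4 → ℝ} (hu : ContDiff ℝ 2 u) (hc : HasCompactSupport u)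
    (hs : tsupport u ⊆ Metric.ball (0 : E4) 1) {x : E4} (hx : x ∈ Metric.ball (0 : E4) 1) :
    ENNReal.ofReal (4 * π ^ 2 * |u x|) ≤
      (∫⁻ y in Metric.ball (0 : E4) 1, ‖adamsField u y * (ballWeight y)⁻¹ ^ 2‖ₑ *
        ENNReal.ofReal (greenKer 0 (ballPair x y))) +
      ∫⁻ y in Metric.ball (0 : E4) 1, ‖9 / 4 * (u y * (ballWeight y)⁻¹ ^ 4)‖ₑ *
        ENNReal.ofReal (greenLog 0 (ballPair x y)) := by
  have hw := ballWeight_pos hx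
  set U : E4 → ℝ := fun y => u y * (ballWeight y)⁻¹ ^ 4 with hUdef
  set F : E4 → ℝ := fun y => adamsField u y * (ballWeight y)⁻¹ ^ 2 with hFdef
  have hF0 : Function.support F ⊆ tsupport u := fun y hy => by
    by_contra h
    exact hy (by simp [F, adamsField_eq_zero h])
  have hUc : Continuous U := (contDiff_mul_ballWeight_inv_pow hu hs 4).continuous
  have hUcs : HasCompactSupport U := hc.mul_right
  have hUs : tsupport U ⊆ Metric.ball (0 : E4) 1 := (tsupport_mul_subset_left).trans hs
  have hfs : tsupport (adamsField u) ⊆ tsupport u := closure_minimal (fun y hy => by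
    by_contra h
    exact hy (adamsField_eq_zero h)) (isClosed_tsupport u)
  have hFc : Continuous F := (contDiff_mul_ballWeight_inv_pow (n := 0)
    (contDiff_zero.2 (continuous_adamsField hu hs)) (hfs.trans hs) 2).continuous
  have hFcs : HasCompactSupport F := hc.mono' hF0
  have hU0 : ∀ y ∉ Metric.ball (0 : E4) 1, U y = 0 := fun y hy =>
    image_eq_zero_of_notMem_tsupport fun h => hy (hUs h)
  have hid : Filter.Tendsto (fun δ : ℝ => δ ^ 2) (nhdsWithin 0 (Set.Ioi 0)) (nhds 0) := by
    have : Continuous fun δ : ℝ => δ ^ 2 := by fun_prop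
    simpa using (this.tendsto 0).mono_left nhdsWithin_le_nhds
  have hfin : ∀ {φ : E4 → ℝ}, Continuous φ → HasCompactSupport φ →
      (∫⁻ y in Metric.ball (0 : E4) 1, ‖φ y‖ₑ) ≠ ⊤ := fun h1 h2 =>
    ((h1.integrable_of_hasCompactSupport h2 (μ := volume)).restrict (s := Metric.ball (0 : E4) 1)).2.ne
  have h0 : Filter.Tendsto (fun δ : ℝ => ENNReal.ofReal (δ ^ 2)) (nhdsWithin 0 (Set.Ioi 0))
      (nhds 0) := by simpa using ENNReal.tendsto_ofReal hid
  have hrhs : ∀ (a : ENNReal) {b : ENNReal}, b ≠ ⊤ →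
      Filter.Tendsto (fun δ : ℝ => a + b * ENNReal.ofReal (δ ^ 2)) (nhdsWithin 0 (Set.Ioi 0))
        (nhds a) := fun a b hb => by
    simpa using (tendsto_const_nhds (x := a)).add (ENNReal.Tendsto.const_mul h0 (Or.inr hb))
  have hU' : Continuous fun y => 9 / 4 * U y := continuous_const.mul hUc
  have hlim := (tendsto_integral_mul_greenBump hUc hUcs hUs hx).const_mul 4
  have hux : 4 * (π ^ 2 * (ballWeight x ^ 4 * U x)) = 4 * π ^ 2 * u x := by
    simp only [U]; field_simp
  rw [hux] at hlim
  have hlhs : ENNReal.ofReal (4 * π ^ 2 * |u x|) = ‖4 * π ^ 2 * u x‖ₑ := by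
    rw [enorm_eq_ofReal_abs, abs_mul, abs_of_pos (a := 4 * π ^ 2) (by positivity)]
  rw [hlhs]
  refine le_of_tendsto_of_tendsto (continuous_enorm.tendsto _ |>.comp hlim)
    ((hrhs _ (hfin hFc hFcs)).add (hrhs _ (hfin hU' hUcs.mul_left))) ?_
  filter_upwards [Ioo_mem_nhdsGT (zero_lt_one' ℝ)] with δ hδ
  have hε : 0 < δ ^ 2 := pow_pos hδ.1 2
  have hε1 : δ ^ 2 ≤ 1 := pow_le_one₀ hδ.1.le hδ.2.le
  have hrep : 4 * ∫ y, U y * greenBump (δ ^ 2) (ballPair x y) =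
      -(∫ y in Metric.ball (0 : E4) 1, F y * greenKer (δ ^ 2) (ballPair x y)) +
        ∫ y in Metric.ball (0 : E4) 1, 9 / 4 * U y * greenLog (δ ^ 2) (ballPair x y) := by
    have h := integral_mul_greenBump hu hc hs hx hε
    have i1 := (integrable_mul_comp_ballPair hUc hUcs hUs
      (fun q hq => contDiffAt_greenBump hε hq) hx).restrict (s := Metric.ball (0 : E4) 1)
    have i2 := (integrable_mul_comp_ballPair hU' hUcs.mul_left
      ((tsupport_mul_subset_right).trans hUs)
      (fun q hq => contDiffAt_greenLog hε hq) hx).restrict (s := Metric.ball (0 : E4) 1)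
    rw [← setIntegral_eq_integral_of_forall_compl_eq_zero (s := Metric.ball (0 : E4) 1)
      fun y hy => by rw [hU0 y hy, zero_mul], ← integral_const_mul, eq_neg_add_iff_add_eq]
    simp only [F]
    rw [h, ← integral_add ?_ (i1.const_mul 4)]
    · refine integral_congr_ae (Filter.Eventually.of_forall fun y => ?_)
      simp only [U]
      ring
    · refine ((i1.const_mul (-4)).add i2).congr (Filter.Eventually.of_forall fun y => ?_)
      simp only [Pi.add_apply, U]
      ring
  simp only [Function.comp_apply]
  rw [hrep]
  refine (enorm_add_le _ _).trans (add_le_add ?_ ?_)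
  · rw [enorm_neg]
    exact enorm_integral_mul_comp_ballPair_le hFc.measurable
      (fun q hq => abs_greenKer_le hε hε1 hq) hx
  · exact enorm_integral_mul_comp_ballPair_le hU'.measurable
      (fun q hq => abs_greenLog_le hε hq) hx

end

noncomputable section

/-- The hyperbolic volume measure of the unit ball, up to a constant factor. -/
def ballMeasure : Measure E4 :=
  (volume.restrict (Metric.ball (0 : E4) 1)).withDensity
    fun y => ENNReal.ofReal ((ballWeight y)⁻¹ ^ 4)

theorem measurable_ballWeight : Measurable ballWeight :=
  (contDiff_ballWeight (n := 0)).continuous.measurable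

theorem measurable_ballPair : Measurable (Function.uncurry ballPair) := by
  have := measurable_ballWeight
  unfold Function.uncurry ballPair
  fun_prop

theorem lintegral_ballMeasure (f : E4 → ENNReal) :
    ∫⁻ y, f y ∂ballMeasure =
      ∫⁻ y in Metric.ball (0 : E4) 1, ENNReal.ofReal ((ballWeight y)⁻¹ ^ 4) * f y := by
  have := measurable_ballWeight
  rw [ballMeasure, lintegral_withDensity_eq_lintegral_mul_non_measurable _ (by fun_prop)
    (Filter.Eventually.of_forall fun _ => ENNReal.ofReal_lt_top)]
  rfl

theorem ae_mem_ball_ballMeasure : ∀ᵐ y ∂ballMeasure, y ∈ Metric.ball (0 : E4) 1 :=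
  (withDensity_absolutelyContinuous _ _).ae_le (ae_restrict_mem measurableSet_ball)

section Inversion

open EuclideanGeometry

variable {c : E4} {R : ℝ}

theorem ballWeight_inversion (hR : R ^ 2 = ‖c‖ ^ 2 - 1) {y : E4} (hy : y ≠ c) :
    ballWeight (inversion c R y) = ballWeight y * (R / dist y c) ^ 2 := by
  have hd : dist y c ≠ 0 := dist_ne_zero.2 hy
  have h1 : inner ℝ (y - c) c = (‖y‖ ^ 2 - dist y c ^ 2 - ‖c‖ ^ 2) / 2 := by
    have := norm_add_sq_real (y - c) c
    rw [sub_add_cancel] at this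
    rw [dist_eq_norm]
    linarith
  rw [ballWeight, ballWeight, inversion, vsub_eq_sub, vadd_eq_add, norm_add_sq_real, norm_smul,
    inner_smul_left, h1, ← dist_eq_norm]
  simp only [norm_eq_abs, mul_pow, sq_abs, conj_trivial]
  field_simp
  linear_combination (dist y c ^ 2 - R ^ 2) * hR

theorem abs_det_fderiv_inversion {y : E4} :
    |((R / dist y c) ^ 2 • ((Submodule.span ℝ {y - c})ᗮ.reflection : E4 →L[ℝ] E4)).det| =
      (R / dist y c) ^ 8 := by
  have h : (((R / dist y c) ^ 2 •
      ((Submodule.span ℝ {y - c})ᗮ.reflection : E4 →L[ℝ] E4)).det : ℝ) =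
      LinearMap.det ((R / dist y c) ^ 2 • (Submodule.span ℝ {y - c})ᗮ.reflection.toLinearMap) := rfl
  rw [h, LinearMap.det_smul, Submodule.det_reflection, abs_mul, abs_neg_one_pow,
    mul_one, abs_of_nonneg (by positivity), finrank_euclideanSpace, Fintype.card_fin,
    ← pow_mul]

theorem lintegral_ballMeasure_inversion (hc : 1 < ‖c‖) (hR : R ^ 2 = ‖c‖ ^ 2 - 1)
    (f : E4 → ENNReal) :
    ∫⁻ y, f y ∂ballMeasure = ∫⁻ y, f (inversion c R y) ∂ballMeasure := by
  have hR0 : R ≠ 0 := by rintro rfl; nlinarith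
  have hne : ∀ y ∈ Metric.ball (0 : E4) 1, y ≠ c := by
    rintro y hy rfl
    exact absurd (mem_ball_zero_iff.1 hy) (by linarith)
  have hmaps : ∀ y ∈ Metric.ball (0 : E4) 1, inversion c R y ∈ Metric.ball (0 : E4) 1 := by
    intro y hy
    have h := ballWeight_inversion hR (hne y hy)
    have hd : dist y c ≠ 0 := dist_ne_zero.2 (hne y hy)
    have h2 : 0 < ballWeight (inversion c R y) := by
      rw [h]
      have := ballWeight_pos hy
      positivity
    rw [mem_ball_zero_iff]
    unfold ballWeight at h2
    nlinarith [norm_nonneg (inversion c R y)]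
  have himage : inversion c R '' Metric.ball (0 : E4) 1 = Metric.ball (0 : E4) 1 := by
    refine Set.Subset.antisymm (Set.image_subset_iff.2 hmaps) fun y hy => ?_
    exact ⟨_, hmaps y hy, inversion_inversion c hR0 y⟩
  rw [lintegral_ballMeasure, lintegral_ballMeasure]
  conv_lhs => rw [← himage]
  rw [lintegral_image_eq_lintegral_abs_det_fderiv_mul volume measurableSet_ball
    (fun y hy => (hasFDerivAt_inversion (hne y hy)).hasFDerivWithinAt)
    (inversion_injective c hR0).injOn]
  refine setLIntegral_congr_fun measurableSet_ball fun y hy => ?_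
  have hd : dist y c ≠ 0 := dist_ne_zero.2 (hne y hy)
  rw [abs_det_fderiv_inversion, ← mul_assoc, ← ENNReal.ofReal_mul (by positivity),
    ballWeight_inversion hR (hne y hy)]
  congr 2
  have := (ballWeight_pos hy).ne'
  field_simp

theorem ballPair_inversion_zero (hc : 1 < ‖c‖) (hR : R ^ 2 = ‖c‖ ^ 2 - 1) {y : E4}
    (hy : y ∈ Metric.ball (0 : E4) 1) :
    ballPair (inversion c R 0) (inversion c R y) = ballPair 0 y := by
  have hR0 : R ≠ 0 := by rintro rfl; nlinarith
  have hne : ∀ y ∈ Metric.ball (0 : E4) 1, y ≠ c := by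
    rintro y hy rfl
    exact absurd (mem_ball_zero_iff.1 hy) (by linarith)
  have h0 : (0 : E4) ∈ Metric.ball (0 : E4) 1 := by simp
  have hd : dist y c ≠ 0 := dist_ne_zero.2 (hne y hy)
  have hd0 : dist 0 c ≠ 0 := dist_ne_zero.2 (hne 0 h0)
  rw [ballPair, ballPair, ← dist_eq_norm, ← dist_eq_norm,
    dist_inversion_inversion (hne 0 h0) (hne y hy), ballWeight_inversion hR (hne 0 h0),
    ballWeight_inversion hR (hne y hy)]
  have := (ballWeight_pos hy).ne'
  have := (ballWeight_pos h0).ne'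
  field_simp

end Inversion

theorem lintegral_comp_ballPair (Φ : ℝ → ENNReal) {x : E4} (hx : x ∈ Metric.ball (0 : E4) 1) :
    ∫⁻ y, Φ (ballPair x y) ∂ballMeasure = ∫⁻ y, Φ (ballPair 0 y) ∂ballMeasure := by
  rcases eq_or_ne x 0 with rfl | hx0
  · rfl
  have hn : 0 < ‖x‖ := norm_pos_iff.2 hx0
  have hn1 : ‖x‖ < 1 := mem_ball_zero_iff.1 hx
  set c : E4 := (‖x‖ ^ 2)⁻¹ • x with hcdef
  have hcn : ‖c‖ = ‖x‖⁻¹ := by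
    rw [hcdef, norm_smul, norm_eq_abs, abs_of_pos (by positivity)]
    field_simp
  have hc : 1 < ‖c‖ := by rw [hcn]; exact (one_lt_inv₀ hn).2 hn1
  have hR : √(‖c‖ ^ 2 - 1) ^ 2 = ‖c‖ ^ 2 - 1 := sq_sqrt (by nlinarith)
  have hx : x = EuclideanGeometry.inversion c √(‖c‖ ^ 2 - 1) 0 := by
    rw [EuclideanGeometry.inversion, dist_zero_left, div_pow, hR, hcn, vsub_eq_sub, vadd_eq_add,
      hcdef, zero_sub, ← neg_smul, smul_smul, ← add_smul]
    have : (‖x‖⁻¹ ^ 2 - 1) / ‖x‖⁻¹ ^ 2 * -(‖x‖ ^ 2)⁻¹ + (‖x‖ ^ 2)⁻¹ = 1 := by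
      field_simp
      ring
    rw [this, one_smul]
  conv_lhs => rw [hx]
  rw [lintegral_ballMeasure_inversion hc hR]
  refine lintegral_congr_ae ?_
  filter_upwards [ae_mem_ball_ballMeasure] with y hy
  rw [ballPair_inversion_zero hc hR hy]

end

noncomputable section

instance : SFinite ballMeasure := by
  unfold ballMeasure
  infer_instance

theorem lintegral_comp_ballPair_le {Φ : ℝ → ENNReal} (hΦ : Measurable Φ) {h : ℝ → ENNReal}
    (hle : ∀ r ∈ Set.Ioo (0 : ℝ) 1,
      ENNReal.ofReal (r ^ 3 * (1 - r ^ 2)⁻¹ ^ 4) * Φ (r ^ 2 * (1 - r ^ 2)⁻¹) ≤ h r)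
    {x : E4} (hx : x ∈ Metric.ball (0 : E4) 1) :
    ∫⁻ y, Φ (ballPair x y) ∂ballMeasure ≤
      ENNReal.ofReal (2 * π ^ 2) * ∫⁻ r in Set.Ioo (0 : ℝ) 1, h r := by
  have h1 : ∀ y : E4, ballPair 0 y = ‖y‖ ^ 2 * (1 - ‖y‖ ^ 2)⁻¹ := fun y => by
    simp [ballPair, ballWeight]
  rw [lintegral_comp_ballPair Φ hx, lintegral_ballMeasure]
  simp only [h1, ballWeight]
  rw [lintegral_ball_fun_norm_E4
    (f := fun r => ENNReal.ofReal ((1 - r ^ 2)⁻¹ ^ 4) * Φ (r ^ 2 * (1 - r ^ 2)⁻¹)) (by fun_prop)]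
  gcongr ENNReal.ofReal (2 * π ^ 2) * ?_
  refine setLIntegral_mono' measurableSet_Ioo fun r hr => ?_
  rw [← mul_assoc, ← ENNReal.ofReal_mul (pow_nonneg hr.1.le 3)]
  exact hle r hr

theorem greenLog_radial_le {r : ℝ} (hr : r ∈ Set.Ioo (0 : ℝ) 1) :
    greenLog 0 (r ^ 2 * (1 - r ^ 2)⁻¹) ≤ (1 - r ^ 2) ^ 2 * r⁻¹ := by
  obtain ⟨h0, h1⟩ := hr
  have hw : 0 < 1 - r ^ 2 := by nlinarith
  have e1 : r ^ 2 * (1 - r ^ 2)⁻¹ + 1 = (1 - r ^ 2)⁻¹ := by field_simp; ring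
  rw [greenLog, add_zero, e1, inv_inv, log_mul (by positivity) (by positivity), log_pow]
  have h2 := self_le_sinh_iff.2 (neg_nonneg.2 (log_nonpos h0.le h1.le))
  rw [sinh_eq, neg_neg, exp_neg, exp_log h0] at h2
  have h3 : (1 - r ^ 2) ^ 2 * r⁻¹ - (r⁻¹ - r - (1 - r ^ 2)) = (1 - r ^ 2) * (1 - r) := by
    field_simp; ring
  have h4 : 0 ≤ (1 - r ^ 2) * (1 - r) := mul_nonneg hw.le (by linarith)
  push_cast
  nlinarith

theorem greenKer_radial_le {r : ℝ} (hr : r ∈ Set.Ioo (0 : ℝ) 1) :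
    greenKer 0 (r ^ 2 * (1 - r ^ 2)⁻¹) ≤ (1 - r ^ 2) ^ 2 * (r⁻¹ ^ 2 + 4⁻¹ * r⁻¹) := by
  have h := greenLog_radial_le hr
  obtain ⟨h0, h1⟩ := hr
  have hw : 0 < 1 - r ^ 2 := by nlinarith
  have e1 : r ^ 2 * (1 - r ^ 2)⁻¹ + 1 = (1 - r ^ 2)⁻¹ := by field_simp; ring
  have e2 : (r ^ 2 * (1 - r ^ 2)⁻¹)⁻¹ - (1 - r ^ 2) = (1 - r ^ 2) ^ 2 * r⁻¹ ^ 2 := by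
    field_simp
  rw [greenKer, add_zero, e1, inv_inv]
  linarith

theorem greenKer_le {q : ℝ} (hq : 0 < q) : greenKer 0 q ≤ 2 * q⁻¹ := by
  have h := log_le_sub_one_of_pos (x := (q + 1) / q) (by positivity)
  rw [log_div (by positivity) hq.ne'] at h
  have e : (q + 1) / q - 1 = q⁻¹ := by field_simp; ring
  have h1 : 0 ≤ (q + 1)⁻¹ := by positivity
  have h2 : 0 ≤ q⁻¹ := by positivity
  simp only [greenKer, greenLog, add_zero]
  linarith

theorem measurable_greenLog (ε : ℝ) : Measurable (greenLog ε) := by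
  unfold greenLog
  fun_prop

theorem measurable_greenKer (ε : ℝ) : Measurable (greenKer ε) := by
  have := measurable_greenLog ε
  unfold greenKer
  fun_prop

theorem lintegral_greenLog_sq_le {x : E4} (hx : x ∈ Metric.ball (0 : E4) 1) :
    ∫⁻ y, ENNReal.ofReal (greenLog 0 (ballPair x y)) ^ 2 ∂ballMeasure ≤
      ENNReal.ofReal (2 * π ^ 2) := by
  have := measurable_greenLog 0
  refine (lintegral_comp_ballPair_le (Φ := fun q => ENNReal.ofReal (greenLog 0 q) ^ 2)
    (h := fun _ => 1) (by fun_prop) (fun r hr => ?_) hx).trans ?_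
  · have h1 := greenLog_radial_le hr
    obtain ⟨hr0, hr1⟩ := hr
    have hw : 0 < 1 - r ^ 2 := by nlinarith
    have h0 := greenLog_nonneg (q := r ^ 2 * (1 - r ^ 2)⁻¹) (by positivity)
    rw [← ENNReal.ofReal_pow h0, ← ENNReal.ofReal_mul (by positivity), ← ENNReal.ofReal_one]
    refine ENNReal.ofReal_le_ofReal ?_
    calc r ^ 3 * (1 - r ^ 2)⁻¹ ^ 4 * greenLog 0 (r ^ 2 * (1 - r ^ 2)⁻¹) ^ 2
        ≤ r ^ 3 * (1 - r ^ 2)⁻¹ ^ 4 * ((1 - r ^ 2) ^ 2 * r⁻¹) ^ 2 := by gcongr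
      _ = r := by field_simp
      _ ≤ 1 := hr1.le
  · simp

theorem lintegral_greenKer_near_le {r₀ : ℝ} (hr₀ : 0 < r₀) (hr₁ : r₀ ≤ 1 / 2) {x : E4}
    (hx : x ∈ Metric.ball (0 : E4) 1) :
    ∫⁻ y, (Set.Iio (r₀ ^ 2)).indicator (fun q => ENNReal.ofReal (greenKer 0 q)) (ballPair x y)
      ∂ballMeasure ≤ ENNReal.ofReal (8 * π ^ 2 * r₀ ^ 2) := by
  have := measurable_greenKer 0
  refine (lintegral_comp_ballPair_le
    (h := (Set.Iio r₀).indicator fun _ => ENNReal.ofReal (4 * r₀))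
    (Measurable.indicator (by fun_prop) measurableSet_Iio) (fun r hr => ?_) hx).trans ?_
  · have hk := greenKer_radial_le hr
    obtain ⟨hr0, hr1⟩ := hr
    have hw : 0 < 1 - r ^ 2 := by nlinarith
    by_cases hq : r ^ 2 * (1 - r ^ 2)⁻¹ < r₀ ^ 2
    · have hrr : r < r₀ := by
        rw [← div_eq_mul_inv, div_lt_iff₀ hw] at hq
        refine lt_of_pow_lt_pow_left₀ 2 hr₀.le (hq.trans_le ?_)
        exact mul_le_of_le_one_right (by positivity) (by nlinarith)
      rw [Set.indicator_of_mem (show _ ∈ Set.Iio (r₀ ^ 2) from hq), Set.indicator_of_mem (show _ ∈ Set.Iio r₀ from hrr),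
        ← ENNReal.ofReal_mul (by positivity)]
      refine ENNReal.ofReal_le_ofReal ?_
      calc r ^ 3 * (1 - r ^ 2)⁻¹ ^ 4 * greenKer 0 (r ^ 2 * (1 - r ^ 2)⁻¹)
          ≤ r ^ 3 * (1 - r ^ 2)⁻¹ ^ 4 * ((1 - r ^ 2) ^ 2 * (r⁻¹ ^ 2 + 4⁻¹ * r⁻¹)) := by gcongr
        _ = ((r + r ^ 2 / 4) * (1 - r ^ 2)⁻¹ ^ 2) := by field_simp
        _ ≤ (2 * r₀) * ((4 : ℝ) / 3) ^ 2 := by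
          gcongr
          · nlinarith
          · rw [inv_le_comm₀ hw (by norm_num)]; nlinarith
        _ ≤ 4 * r₀ := by nlinarith
    · rw [Set.indicator_of_notMem (show _ ∉ Set.Iio (r₀ ^ 2) from hq), mul_zero]
      exact zero_le
  · rw [lintegral_indicator_const measurableSet_Iio,
      Measure.restrict_apply measurableSet_Iio]
    calc _ ≤ ENNReal.ofReal (2 * π ^ 2) * (ENNReal.ofReal (4 * r₀) * volume (Set.Ioo 0 r₀)) := by
          gcongr
          exact fun r hr => ⟨hr.2.1, hr.1⟩
      _ = _ := by
        rw [Real.volume_Ioo, ← ENNReal.ofReal_mul (by positivity),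
          ← ENNReal.ofReal_mul (by positivity)]
        congr 1; ring

theorem lintegral_greenKer_far_sq_le {r₀ : ℝ} (hr₀ : 0 < r₀) (hr₁ : r₀ ≤ 1 / 2) {x : E4}
    (hx : x ∈ Metric.ball (0 : E4) 1) :
    ∫⁻ y, (Set.Ici (r₀ ^ 2)).indicator (fun q => ENNReal.ofReal (greenKer 0 q)) (ballPair x y) ^ 2
      ∂ballMeasure ≤ ENNReal.ofReal (2 * π ^ 2 * (log (1 / r₀) + 2)) := by
  have := measurable_greenKer 0
  have hmeas : Measurable ((Set.Ici (r₀ ^ 2)).indicator fun q => ENNReal.ofReal (greenKer 0 q)) :=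
    Measurable.indicator (by fun_prop) measurableSet_Ici
  refine (lintegral_comp_ballPair_le
    (Φ := fun q => (Set.Ici (r₀ ^ 2)).indicator (fun q => ENNReal.ofReal (greenKer 0 q)) q ^ 2)
    (h := (Set.Ici (r₀ / 2)).indicator fun r => ENNReal.ofReal (r⁻¹ + 1))
    (hmeas.pow_const 2) (fun r hr => ?_) hx).trans ?_
  · have hk := greenKer_radial_le hr
    obtain ⟨hr0, hr1⟩ := hr
    have hw : 0 < 1 - r ^ 2 := by nlinarith
    have h0 := greenKer_nonneg (q := r ^ 2 * (1 - r ^ 2)⁻¹) (by positivity)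
    by_cases hq : r₀ ^ 2 ≤ r ^ 2 * (1 - r ^ 2)⁻¹
    · have hrr : r₀ / 2 ≤ r := by
        rw [← div_eq_mul_inv, le_div_iff₀ hw] at hq
        refine le_of_pow_le_pow_left₀ two_ne_zero hr0.le ?_
        have : r₀ ^ 2 ≤ 1 / 4 := by nlinarith
        nlinarith [mul_nonneg (sq_nonneg r) (sub_nonneg.2 this)]
      rw [Set.indicator_of_mem (show _ ∈ Set.Ici (r₀ ^ 2) from hq),
        Set.indicator_of_mem (show _ ∈ Set.Ici (r₀ / 2) from hrr), ← ENNReal.ofReal_pow h0,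
        ← ENNReal.ofReal_mul (by positivity)]
      refine ENNReal.ofReal_le_ofReal ?_
      calc r ^ 3 * (1 - r ^ 2)⁻¹ ^ 4 * greenKer 0 (r ^ 2 * (1 - r ^ 2)⁻¹) ^ 2
          ≤ r ^ 3 * (1 - r ^ 2)⁻¹ ^ 4 * ((1 - r ^ 2) ^ 2 * (r⁻¹ ^ 2 + 4⁻¹ * r⁻¹)) ^ 2 := by gcongr
        _ = r⁻¹ + 2⁻¹ + r / 16 := by field_simp; ring
        _ ≤ r⁻¹ + 1 := by linarith
    · rw [Set.indicator_of_notMem (show _ ∉ Set.Ici (r₀ ^ 2) from hq)]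
      simp
  · rw [lintegral_indicator measurableSet_Ici, Measure.restrict_restrict measurableSet_Ici,
      ENNReal.ofReal_mul (p := 2 * π ^ 2) (by positivity)]
    gcongr
    have hsub : Set.Ici (r₀ / 2) ∩ Set.Ioo 0 1 ⊆ Set.Icc (r₀ / 2) 1 := fun r hr => ⟨hr.1, hr.2.2.le⟩
    refine (lintegral_mono_set hsub).trans ?_
    rw [← restrict_Ioc_eq_restrict_Icc]
    have hle : r₀ / 2 ≤ 1 := by linarith
    have hInt : IntervalIntegrable (fun r : ℝ => r⁻¹) volume (r₀ / 2) 1 :=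
      intervalIntegral.intervalIntegrable_inv (fun r hr => by
        rw [Set.uIcc_of_le hle] at hr
        exact (show 0 < r by linarith [hr.1]).ne') continuousOn_id
    have hint1 : IntervalIntegrable (fun _ : ℝ => (1 : ℝ)) volume (r₀ / 2) 1 :=
      intervalIntegrable_const
    rw [← ofReal_integral_eq_lintegral_ofReal (hInt.add hint1).1]
    · refine ENNReal.ofReal_le_ofReal ?_
      rw [← intervalIntegral.integral_of_le hle]
      have := intervalIntegral.integral_add hInt hint1
      rw [this, integral_inv_of_pos (by positivity) one_pos, intervalIntegral.integral_const,
        show 1 / (r₀ / 2) = 1 / r₀ * 2 by ring, log_mul (by positivity) two_ne_zero]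
      have := log_two_lt_d9
      norm_num
      linarith
    · filter_upwards [ae_restrict_mem measurableSet_Ioc] with r hr
      have : 0 < r := by linarith [hr.1]
      simp only [Pi.zero_apply]
      positivity

end

noncomputable section

theorem lintegral_greenKer_mul_le {S : Set E4} (hS0 : ballMeasure S ≠ 0)
    (hS : ballMeasure S ≤ ENNReal.ofReal (1 / 16)) {x' : E4} (hx' : x' ∈ Metric.ball (0 : E4) 1) :
    ∫⁻ x in S, ∫⁻ y, ENNReal.ofReal (greenKer 0 (ballPair x y)) *
        ENNReal.ofReal (greenKer 0 (ballPair x' y)) ∂ballMeasure ∂ballMeasure ≤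
      ballMeasure S * ENNReal.ofReal (π ^ 2 / 2 * log (1 / (ballMeasure S).toReal) +
        (36 * π ^ 2 + 64 * π ^ 4)) := by
  have hmeas := measurable_greenKer 0
  have hpair := measurable_ballPair
  have htop : ballMeasure S ≠ ⊤ := ne_top_of_le_ne_top ENNReal.ofReal_ne_top hS
  set m : ℝ := (ballMeasure S).toReal with hm
  have hm0 : 0 < m := ENNReal.toReal_pos hS0 htop
  have hm1 : m ≤ 1 / 16 := ENNReal.toReal_le_of_le_ofReal (by norm_num) hS
  have hmS : ballMeasure S = ENNReal.ofReal m := (ENNReal.ofReal_toReal htop).symm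
  set r₀ : ℝ := √√m with hr
  have hr4 : r₀ ^ 4 = m := by
    rw [hr, show (4 : ℕ) = 2 * 2 from rfl, pow_mul, sq_sqrt (sqrt_nonneg _), sq_sqrt hm0.le]
  have hr0 : 0 < r₀ := sqrt_pos.2 (sqrt_pos.2 hm0)
  have hr1 : r₀ ≤ 1 / 2 :=
    le_of_pow_le_pow_left₀ (n := 4) (by norm_num) (by norm_num) (by rw [hr4]; norm_num [hm1])
  have hlog : log (1 / m) = 4 * log (1 / r₀) := by
    rw [← hr4, one_div, one_div, ← inv_pow, log_pow]; norm_num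
  have hlog0 : 0 ≤ log (1 / r₀) := log_nonneg (by rw [le_div_iff₀ hr0]; linarith)
  have hnear : Measurable ((Set.Iio (r₀ ^ 2)).indicator fun q => ENNReal.ofReal (greenKer 0 q)) :=
    Measurable.indicator (by fun_prop) measurableSet_Iio
  have hfar : Measurable ((Set.Ici (r₀ ^ 2)).indicator fun q => ENNReal.ofReal (greenKer 0 q)) :=
    Measurable.indicator (by fun_prop) measurableSet_Ici
  refine (lintegral_mul_kernel_le (κ := fun x y => ENNReal.ofReal (greenKer 0 (ballPair x y)))
    (p := fun x y => (Set.Iio (r₀ ^ 2)).indicator (fun q => ENNReal.ofReal (greenKer 0 q))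
      (ballPair x y))
    (q := fun x y => (Set.Ici (r₀ ^ 2)).indicator (fun q => ENNReal.ofReal (greenKer 0 q))
      (ballPair x y))
    (D := ENNReal.ofReal (2 / r₀ ^ 2)) (A := ENNReal.ofReal (8 * π ^ 2 * r₀ ^ 2))
    (N := ENNReal.ofReal (2 * π ^ 2 * (log (1 / r₀) + 2)))
    (hnear.comp hpair) (hfar.comp hpair) (fun x y => ?_) (fun x y => ?_) ?_ (fun x y => ?_) ?_
    (lintegral_greenKer_near_le hr0 hr1 hx') (lintegral_greenKer_far_sq_le hr0 hr1 hx') S).trans ?_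
  · rcases lt_or_ge (ballPair x y) (r₀ ^ 2) with h | h
    · rw [Set.indicator_of_mem (show _ ∈ Set.Iio (r₀ ^ 2) from h)]
      exact le_self_add
    · rw [Set.indicator_of_mem (show _ ∈ Set.Ici (r₀ ^ 2) from h)]
      exact le_add_self
  · rw [ballPair_comm]
  · filter_upwards [ae_mem_ball_ballMeasure] with x hx using lintegral_greenKer_near_le hr0 hr1 hx
  · rw [Set.indicator_apply]
    split_ifs with h
    · have hq : r₀ ^ 2 ≤ ballPair x y := h
      refine ENNReal.ofReal_le_ofReal ((greenKer_le ((by positivity : 0 < r₀ ^ 2).trans_le hq)).trans ?_)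
      rw [div_eq_mul_inv]
      gcongr
    · exact zero_le
  · filter_upwards [ae_mem_ball_ballMeasure] with x hx using
      lintegral_greenKer_far_sq_le hr0 hr1 hx
  · have h2 : (2 : ENNReal) = ENNReal.ofReal 2 := by simp
    rw [hmS, h2, ← ENNReal.ofReal_mul (by positivity), ← ENNReal.ofReal_mul (by positivity),
      ← ENNReal.ofReal_add (by positivity) (by positivity), ← ENNReal.ofReal_mul (by positivity),
      ← ENNReal.ofReal_mul (by positivity), ← ENNReal.ofReal_add (by positivity) (by positivity),
      ← ENNReal.ofReal_mul (by positivity), hlog, ← hr4]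
    refine ENNReal.ofReal_le_ofReal (le_of_eq ?_)
    field_simp
    ring

theorem lintegral_greenLog_mul_le {c : ℝ} (hc : 0 ≤ c) (S : Set E4) {x' : E4}
    (hx' : x' ∈ Metric.ball (0 : E4) 1) :
    ∫⁻ x in S, ∫⁻ y, ENNReal.ofReal (c * greenLog 0 (ballPair x y)) *
        ENNReal.ofReal (c * greenLog 0 (ballPair x' y)) ∂ballMeasure ∂ballMeasure ≤
      ballMeasure S * ENNReal.ofReal (2 * π ^ 2 * c ^ 2) := by
  have hmeas := measurable_greenLog 0
  have hpair : ∀ x, Measurable (ballPair x) := fun x => measurable_ballPair.of_uncurry_left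
  have hsq : ∀ x ∈ Metric.ball (0 : E4) 1,
      ∫⁻ y, ENNReal.ofReal (c * greenLog 0 (ballPair x y)) ^ 2 ∂ballMeasure ≤
        ENNReal.ofReal (2 * π ^ 2 * c ^ 2) := fun x hx => by
    have h := hpair x
    simp only [ENNReal.ofReal_mul hc, mul_pow]
    rw [lintegral_const_mul _ (by fun_prop), mul_comm (2 * π ^ 2), ENNReal.ofReal_mul (by positivity),
      ENNReal.ofReal_pow hc]
    gcongr
    exact lintegral_greenLog_sq_le hx
  have hle : ∀ x ∈ Metric.ball (0 : E4) 1,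
      ∫⁻ y, ENNReal.ofReal (c * greenLog 0 (ballPair x y)) *
        ENNReal.ofReal (c * greenLog 0 (ballPair x' y)) ∂ballMeasure ≤
          ENNReal.ofReal (2 * π ^ 2 * c ^ 2) := fun x hx => by
    have h := hpair x
    have h' := hpair x'
    calc _ ≤ ∫⁻ y, (2⁻¹ * ENNReal.ofReal (c * greenLog 0 (ballPair x y)) ^ 2 +
          2⁻¹ * ENNReal.ofReal (c * greenLog 0 (ballPair x' y)) ^ 2) ∂ballMeasure :=
        lintegral_mono fun y => ENNReal.mul_le_half_add_sq _ _
      _ ≤ 2⁻¹ * ENNReal.ofReal (2 * π ^ 2 * c ^ 2) + 2⁻¹ * ENNReal.ofReal (2 * π ^ 2 * c ^ 2) := by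
        rw [lintegral_add_left (by fun_prop), lintegral_const_mul _ (by fun_prop),
          lintegral_const_mul _ (by fun_prop)]
        gcongr
        · exact hsq x hx
        · exact hsq x' hx'
      _ = _ := by rw [← add_mul, ENNReal.inv_two_add_inv_two, one_mul]
  calc _ ≤ ∫⁻ _ in S, ENNReal.ofReal (2 * π ^ 2 * c ^ 2) ∂ballMeasure :=
        lintegral_mono_ae ((ae_restrict_of_ae ae_mem_ball_ballMeasure).mono hle)
    _ = _ := by rw [setLIntegral_const, mul_comm]

theorem lintegral_gramKernel_green_le {c : ℝ} (hc : 0 ≤ c) {S : Set E4} (hS0 : ballMeasure S ≠ 0)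
    (hS : ballMeasure S ≤ ENNReal.ofReal (1 / 16)) :
    ∀ᵐ x' ∂ballMeasure, ∫⁻ x in S, gramKernel ballMeasure
        (fun x y => ENNReal.ofReal (greenKer 0 (ballPair x y)))
        (fun x y => ENNReal.ofReal (c * greenLog 0 (ballPair x y))) x x' ∂ballMeasure ≤
      ballMeasure S * ENNReal.ofReal (π ^ 2 / 2 * log (1 / (ballMeasure S).toReal) +
        (36 * π ^ 2 + 64 * π ^ 4 + 2 * π ^ 2 * c ^ 2)) := by
  have hmeas := measurable_greenKer 0
  have hpair := measurable_ballPair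
  have hk : Measurable (Function.uncurry fun x y => ENNReal.ofReal (greenKer 0 (ballPair x y))) :=
    (hmeas.comp hpair).ennreal_ofReal
  filter_upwards [ae_mem_ball_ballMeasure] with x' hx'
  simp only [gramKernel]
  rw [lintegral_add_left]
  · refine (add_le_add (lintegral_greenKer_mul_le hS0 hS hx')
      (lintegral_greenLog_mul_le hc S hx')).trans_eq ?_
    have htop : ballMeasure S ≠ ⊤ := ne_top_of_le_ne_top ENNReal.ofReal_ne_top hS
    have hm0 : 0 < (ballMeasure S).toReal := ENNReal.toReal_pos hS0 htop
    have hm1 := ENNReal.toReal_le_of_le_ofReal (by norm_num) hS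
    have hlog : 0 ≤ log (1 / (ballMeasure S).toReal) :=
      log_nonneg (by rw [le_div_iff₀ hm0]; linarith)
    rw [← mul_add, ← ENNReal.ofReal_add (by positivity) (by positivity)]
    congr 2
    ring
  · have hl : Measurable fun z : E4 × E4 => ENNReal.ofReal (greenKer 0 (ballPair x' z.2)) :=
      (hmeas.comp (hpair.comp (measurable_const.prodMk measurable_snd))).ennreal_ofReal
    exact Measurable.lintegral_prod_right' (ν := ballMeasure) (hk.mul hl)

end

theorem improved_adams (lam : ℝ) (hlam : lam < 9) :
    ∃ C : ℝ, 0 < C ∧ ∀ u : E4 → ℝ, ContDiff ℝ (⊤ : ℕ∞) u → HasCompactSupport u →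
      tsupport u ⊆ Metric.ball (0 : E4) 1 →
      (∫ x in Metric.ball (0 : E4) 1, |lapE u x| ^ 2)
        - lam * (∫ x in Metric.ball (0 : E4) 1, u x ^ 2 / (1 - ‖x‖ ^ 2) ^ 4) ≤ 1 →
      16 * (∫ x in Metric.ball (0 : E4) 1,
          (Real.exp (32 * π ^ 2 * u x ^ 2) - 1) / (1 - ‖x‖ ^ 2) ^ 4) ≤ C := by
  obtain ⟨κ, rfl⟩ : ∃ κ, lam = 9 - κ := ⟨9 - lam, by ring⟩
  have hκ : 0 < κ := by linarith
  set c : ℝ := 9 / 4 / √κ with hc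
  have hc0 : 0 ≤ c := by positivity
  have hκs : c * √κ = 9 / 4 := div_mul_cancel₀ _ (Real.sqrt_pos.2 hκ).ne'
  obtain ⟨K, hK⟩ := exists_lintegral_exp_sub_one_le (μ := ballMeasure)
    (k := fun x y => ENNReal.ofReal (greenKer 0 (ballPair x y)))
    (l := fun x y => ENNReal.ofReal (c * greenLog 0 (ballPair x y)))
    (M := π ^ 2 / 2) (C := 36 * π ^ 2 + 64 * π ^ 4 + 2 * π ^ 2 * c ^ 2) (γ := 4 * π ^ 2)
    (β := 32 * π ^ 2) (V := 1 / κ)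
    ((measurable_greenKer 0).comp measurable_ballPair).ennreal_ofReal
    (((measurable_greenLog 0).comp measurable_ballPair).const_mul c).ennreal_ofReal
    (by positivity) (by positivity) (by positivity) (by positivity) (by ring) (by positivity)
    fun S _ hS0 hS => lintegral_gramKernel_green_le hc0 hS0 hS
  refine ⟨16 * max K 0 + 1, by positivity, fun u hu hcs hs hE => ?_⟩
  have hu2 : ContDiff ℝ 2 u := contDiff_infty.1 hu 2
  have hfc := continuous_adamsField hu2 hs
  have henergy := integral_sq_adamsField_le hu2 hcs hs
  have hmw := measurable_ballWeight
  set F : ℝ := ∫ x in Metric.ball (0 : E4) 1, adamsField u x ^ 2 with hF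
  set W : ℝ := ∫ x in Metric.ball (0 : E4) 1, u x ^ 2 / (1 - ‖x‖ ^ 2) ^ 4 with hWdef
  have hF0 : 0 ≤ F := integral_nonneg fun x => sq_nonneg _
  have hW0 : 0 ≤ W := integral_nonneg fun x => by positivity
  have hFW : F + κ * W ≤ 1 := by linarith
  have hFint : ∫⁻ y in Metric.ball (0 : E4) 1, ENNReal.ofReal (adamsField u y ^ 2) =
      ENNReal.ofReal F := by
    refine (ofReal_integral_eq_lintegral_ofReal (Integrable.restrict ?_)
      (Filter.Eventually.of_forall fun y => sq_nonneg _)).symm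
    refine (hfc.pow 2).integrable_of_hasCompactSupport (HasCompactSupport.intro hcs fun x hx => ?_)
    simp [adamsField_eq_zero hx]
  have hWint : ∫⁻ y, ENNReal.ofReal (|u y| ^ 2) ∂ballMeasure = ENNReal.ofReal W := by
    have hsq : tsupport (fun x => u x * u x) ⊆ Metric.ball 0 1 := (tsupport_mul_subset_left).trans hs
    have hcont := (contDiff_mul_ballWeight_inv_pow (hu2.mul hu2) hsq 4).continuous
    have heq : (fun x : E4 => u x * u x * (ballWeight x)⁻¹ ^ 4) =
        fun x => u x ^ 2 / (1 - ‖x‖ ^ 2) ^ 4 := by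
      funext x
      rw [inv_pow, ← div_eq_mul_inv, ballWeight, ← sq]
    rw [heq] at hcont
    rw [lintegral_ballMeasure, hWdef, ofReal_integral_eq_lintegral_ofReal (Integrable.restrict ?_)
      (Filter.Eventually.of_forall fun y => by positivity)]
    · refine lintegral_congr fun y => ?_
      rw [← ENNReal.ofReal_mul (by positivity), sq_abs, ← ballWeight, inv_pow, div_eq_inv_mul]
    · refine hcont.integrable_of_hasCompactSupport (HasCompactSupport.intro hcs fun x hx => ?_)
      simp [image_eq_zero_of_notMem_tsupport hx]
  have hbound := hK (fun x => |u x|) (fun y => ‖adamsField u y * ballWeight y ^ 2‖ₑ)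
    (fun y => ‖√κ * u y‖ₑ) hu2.continuous.abs.measurable (fun x => abs_nonneg _)
    (hfc.measurable.mul (hmw.pow_const 2)).enorm
    (hu2.continuous.measurable.const_mul _).enorm ?_ ?_ ?_
  · have hInt : ∫ x in Metric.ball (0 : E4) 1,
        (Real.exp (32 * π ^ 2 * u x ^ 2) - 1) / (1 - ‖x‖ ^ 2) ^ 4 ≤ max K 0 := by
      rw [integral_eq_lintegral_of_nonneg_ae]
      · refine ENNReal.toReal_le_of_le_ofReal (le_max_right _ _) (le_trans (le_of_eq ?_)
          (hbound.trans (ENNReal.ofReal_le_ofReal (le_max_left _ _))))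
        rw [lintegral_ballMeasure]
        refine lintegral_congr fun y => ?_
        rw [← ENNReal.ofReal_mul (by positivity), sq_abs, ← ballWeight, inv_pow, div_eq_inv_mul]
      · refine Filter.Eventually.of_forall fun y => ?_
        have : 1 ≤ rexp (32 * π ^ 2 * u y ^ 2) := one_le_exp (by positivity)
        exact div_nonneg (by linarith) (by positivity)
      · have := hu2.continuous.measurable
        exact Measurable.aestronglyMeasurable (by fun_prop)
    linarith
  · filter_upwards [ae_mem_ball_ballMeasure] with x hx
    refine (ofReal_abs_le_lintegral_green hu2 hcs hs hx).trans_eq ?_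
    rw [lintegral_ballMeasure, lintegral_ballMeasure]
    congr 1
    · refine setLIntegral_congr_fun measurableSet_ball fun y hy => ?_
      have hw := ballWeight_pos hy
      have e : adamsField u y * (ballWeight y)⁻¹ ^ 2 =
          (ballWeight y)⁻¹ ^ 4 * (adamsField u y * ballWeight y ^ 2) := by
        field_simp
      rw [e, enorm_mul, enorm_eq_ofReal (by positivity : 0 ≤ (ballWeight y)⁻¹ ^ 4)]
      ring
    · refine setLIntegral_congr_fun measurableSet_ball fun y hy => ?_
      have hw := ballWeight_pos hy
      have e : 9 / 4 * (u y * (ballWeight y)⁻¹ ^ 4) =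
          (ballWeight y)⁻¹ ^ 4 * c * (√κ * u y) := by
        rw [← hκs]
        ring
      rw [e, enorm_mul, enorm_eq_ofReal (by positivity : 0 ≤ (ballWeight y)⁻¹ ^ 4 * c),
        ENNReal.ofReal_mul (by positivity), ENNReal.ofReal_mul hc0]
      ring
  · have ha : ∫⁻ y, ‖adamsField u y * ballWeight y ^ 2‖ₑ ^ 2 ∂ballMeasure = ENNReal.ofReal F := by
      rw [lintegral_ballMeasure, ← hFint]
      refine setLIntegral_congr_fun measurableSet_ball fun y hy => ?_
      have hw := ballWeight_pos hy
      rw [enorm_eq_ofReal_abs, ← ENNReal.ofReal_pow (abs_nonneg _), sq_abs,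
        ← ENNReal.ofReal_mul (by positivity)]
      congr 1
      field_simp
    have hb : ∫⁻ y, ‖√κ * u y‖ₑ ^ 2 ∂ballMeasure = ENNReal.ofReal (κ * W) := by
      rw [ENNReal.ofReal_mul hκ.le, ← hWint, ← lintegral_const_mul' _ _ ENNReal.ofReal_ne_top]
      refine lintegral_congr fun y => ?_
      rw [enorm_eq_ofReal_abs, ← ENNReal.ofReal_pow (abs_nonneg _), ← ENNReal.ofReal_mul hκ.le,
        sq_abs, sq_abs, mul_pow, Real.sq_sqrt hκ.le]
    rw [ha, hb, ← ENNReal.ofReal_add hF0 (by positivity)]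
    exact ENNReal.ofReal_le_one.2 hFW
  · rw [hWint]
    refine ENNReal.ofReal_le_ofReal ?_
    rw [le_div_iff₀ hκ]
    linarith
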